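/- arXiv:1201.0276 — 3 statements merged into one kernel-verified Lean document; each statement's English description precedes it below -/
import Mathlib

section
/- Let A = {−1,1}. Then s_A(C_3^4) = 21; that is, every sequence over C_3^4 of length at least 21 has an A-zero-sum subsequence of length 3, and there exists a sequence over C_3^4 of length 20 with no A-zero-sum subsequence of length 3. -/
/-- A multiset `S` over an additive abelian group `G` has an `A`-zero-sum subsequence
of length `k`, for the weight set `A = {-1, 1}`: there is a sub-multiset of `S` of
cardinality `k` that splits as `t₁ + t₂` with `t₁.sum - t₂.sum = 0` (the elements of
`t₁` receive the weight `+1` and those of `t₂` the weight `-1`). -/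
def HasWZSS {G : Type*} [AddCommGroup G] (S : Multiset G) (k : ℕ) : Prop :=
  ∃ t₁ t₂ : Multiset G, t₁ + t₂ ≤ S ∧ Multiset.card (t₁ + t₂) = k ∧ t₁.sum = t₂.sum

/-- `sA G` is the smallest `ℓ` such that every sequence over `G` of length at least `ℓ`
has an `{-1,1}`-zero-sum subsequence of length `exp G`. -/
noncomputable def sA (G : Type*) [AddCommGroup G] : ℕ :=
  sInf {ℓ : ℕ | ∀ S : Multiset G, ℓ ≤ Multiset.card S →
    HasWZSS S (AddMonoid.exponent G)}

/-- `etaA G` is the smallest `ℓ` such that every sequence over `G` of length at least `ℓ`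
has a nonempty `{-1,1}`-zero-sum subsequence of length at most `exp G`. -/
noncomputable def etaA (G : Type*) [AddCommGroup G] : ℕ :=
  sInf {ℓ : ℕ | ∀ S : Multiset G, ℓ ≤ Multiset.card S →
    ∃ k, 1 ≤ k ∧ k ≤ AddMonoid.exponent G ∧ HasWZSS S k}

/-- `gA G` is the smallest `ℓ` such that every sequence over `G` of length at least `ℓ`
consisting of pairwise distinct elements has an `{-1,1}`-zero-sum subsequence of
length `exp G`. -/
noncomputable def gA (G : Type*) [AddCommGroup G] : ℕ :=
  sInf {ℓ : ℕ | ∀ S : Multiset G, ℓ ≤ Multiset.card S → S.Nodup →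
    HasWZSS S (AddMonoid.exponent G)}

abbrev V34 := Fin 4 → ZMod 3

lemma three_mul_V (v : V34) : v + v + v = 0 := by
  funext i
  have : ∀ x : ZMod 3, x + x + x = 0 := by decide
  exact this (v i)

lemma neg_eq_V (v : V34) : -v = v + v := by
  have := three_mul_V v
  exact neg_eq_of_add_eq_zero_left this

lemma zmod3_cases : ∀ x : ZMod 3, x = 0 ∨ x = 1 ∨ x = -1 := by decide

lemma zero_of_eq_neg (v : V34) (h : v = -v) : v = 0 := by
  have := three_mul_V v
  have h2 : v + v = 0 := by nth_rewrite 1 [h]; simp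
  simpa [h2] using this

/-- Core cap bound: a symmetric set of nonzero vectors that contains no sum of two of its
distinct elements has at most 20 elements. -/
lemma cap_bound (P : Finset V34) (h0 : (0 : V34) ∉ P) (hneg : ∀ v ∈ P, -v ∈ P)
    (hadd : ∀ a ∈ P, ∀ b ∈ P, a ≠ b → a + b ∉ P) : P.card ≤ 20 := by
  classical
  by_contra hcard
  push Not at hcard
  obtain ⟨a, ha⟩ : P.Nonempty := Finset.card_pos.mp (by omega)
  obtain ⟨b, hb, hba⟩ : ∃ b ∈ P, b ∉ ({a, -a} : Finset V34) :=
    Finset.exists_mem_notMem_of_card_lt_card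
      (lt_of_le_of_lt (Finset.card_le_two) (by omega))
  simp only [Finset.mem_insert, Finset.mem_singleton, not_or] at hba
  obtain ⟨hba1, hba2⟩ := hba
  have hna := hneg a ha
  have hnb := hneg b hb
  have hane : a ≠ 0 := fun h => h0 (h ▸ ha)
  have hbne : b ≠ 0 := fun h => h0 (h ▸ hb)
  have hsub : ∀ c ∈ P, ∀ d ∈ P, c ≠ -d → c - d ∉ P := by
    intro c hc d hd hcd
    rw [sub_eq_add_neg]
    exact hadd c hc (-d) (hneg d hd) hcd
  -- the span of `a, b`
  let W : Submodule (ZMod 3) V34 := Submodule.span (ZMod 3) {a, b}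
  have haW : a ∈ W := Submodule.subset_span (by simp)
  have hbW : b ∈ W := Submodule.subset_span (by simp)
  have hlin : LinearIndependent (ZMod 3) ![a, b] := by
    rw [LinearIndependent.pair_iff]
    intro s t hst
    rcases zmod3_cases s with rfl | rfl | rfl <;> rcases zmod3_cases t with rfl | rfl | rfl <;>
      simp at hst ⊢
    · exact hbne hst
    · exact hbne hst
    · exact hane hst
    · exact hba2 (eq_neg_of_add_eq_zero_right hst)
    · exact hba1 (by rw [← sub_eq_add_neg, sub_eq_zero] at hst; exact hst.symm)
    · exact hane hst
    · exact hba1 (neg_add_eq_zero.mp hst).symm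
    · exact hba2 (by
        have : b = -a := by
          have h : -a = b := by
            have := eq_neg_of_add_eq_zero_left hst
            simpa using this
          exact h.symm
        exact this)
  have hrank : Module.finrank (ZMod 3) W = 2 := by
    have := finrank_span_eq_card hlin
    have hr : Set.range ![a, b] = {a, b} := by
      simp only [Matrix.range_cons, Matrix.range_empty, Set.union_empty]
      rfl
    rw [hr] at this
    simpa using this
  have hQ : Module.finrank (ZMod 3) (V34 ⧸ W) = 2 := by
    have := Submodule.finrank_quotient_add_finrank W
    rw [hrank] at this
    simp at this
    omega
  have : Fintype (V34 ⧸ W) := Fintype.ofFinite _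
  have hQc : Fintype.card (V34 ⧸ W) = 9 := by
    rw [Module.card_eq_pow_finrank (K := ZMod 3), hQ]; simp
  have hWform : ∀ w ∈ W, w = 0 ∨ w = a ∨ w = -a ∨ w = b ∨ w = -b ∨
      w = a + b ∨ w = a - b ∨ w = -a + b ∨ w = -a - b := by
    intro w hw
    obtain ⟨s, t, rfl⟩ := Submodule.mem_span_pair.mp hw
    rcases zmod3_cases s with rfl | rfl | rfl <;> rcases zmod3_cases t with rfl | rfl | rfl <;>
      simp [sub_eq_add_neg]
  have hab : a ≠ b := fun h => hba1 h.symm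
  have hanb : a ≠ -b := fun h => hba2 (by rw [h]; simp)
  let R : Finset V34 := P \ {a, -a, b, -b}
  have hR4 : 17 ≤ R.card := by
    have h1 := Finset.le_card_sdiff ({a, -a, b, -b} : Finset V34) P
    have h2 : ({a, -a, b, -b} : Finset V34).card ≤ 4 := Finset.card_le_four
    show 17 ≤ (P \ {a, -a, b, -b}).card
    omega
  have hRmem : ∀ c ∈ R, c ∈ P ∧ c ≠ a ∧ c ≠ -a ∧ c ≠ b ∧ c ≠ -b := by
    intro c hc
    simpa [R] using hc
  have hmaps : ∀ c ∈ R, W.mkQ c ∈ (Finset.univ.erase 0 : Finset (V34 ⧸ W)) := by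
    intro c hc
    obtain ⟨hcP, h1, h2, h3, h4⟩ := hRmem c hc
    simp only [Finset.mem_erase, Finset.mem_univ, and_true]
    intro hz
    have hcW : c ∈ W := by simpa using hz
    rcases hWform c hcW with h | h | h | h | h | h | h | h | h
    · exact h0 (h ▸ hcP)
    · exact h1 h
    · exact h2 h
    · exact h3 h
    · exact h4 h
    · exact hadd a ha b hb hab (h ▸ hcP)
    · exact hsub a ha b hb hanb (h ▸ hcP)
    · exact hadd (-a) hna b hb (Ne.symm hba2) (h ▸ hcP)
    · exact hsub (-a) hna b hb (by simpa using hab) (h ▸ hcP)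
  obtain ⟨q, -, hq⟩ := Finset.exists_lt_card_fiber_of_mul_lt_card_of_maps_to (n := 2) hmaps
    (by rw [Finset.card_erase_of_mem (Finset.mem_univ _), Finset.card_univ, hQc]; omega)
  obtain ⟨c, d, e, hc, hd, he, hcd, hce, hde⟩ := Finset.two_lt_card_iff.mp hq
  simp only [Finset.mem_filter] at hc hd he
  -- differences
  have hdiff : ∀ x ∈ R, ∀ y ∈ R, x ≠ y → W.mkQ x = W.mkQ y →
      x - y = a + b ∨ x - y = a - b ∨ x - y = -a + b ∨ x - y = -a - b := by
    intro x hx y hy hxy hm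
    have hw : x - y ∈ W := (Submodule.Quotient.eq W).mp hm
    obtain ⟨hxP, hx1, hx2, hx3, hx4⟩ := hRmem x hx
    obtain ⟨hyP, hy1, hy2, hy3, hy4⟩ := hRmem y hy
    have key : ∀ u ∈ P, y ≠ u → x - y ≠ u := by
      intro u hu hyu h
      have : x = y + u := by rw [← h]; abel
      exact hadd y hyP u hu hyu (this ▸ hxP)
    rcases hWform _ hw with h | h | h | h | h | h
    · exact absurd (sub_eq_zero.mp h) hxy
    · exact absurd h (key a ha hy1)
    · exact absurd h (key (-a) hna hy2)
    · exact absurd h (key b hb hy3)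
    · exact absurd h (key (-b) hnb hy4)
    · exact h
  have hde' : ∀ u ∈ P, e ≠ u → d - e ≠ u := by
    intro u hu heu h
    have : d = e + u := by rw [← h]; abel
    exact hadd e (hRmem e he.1).1 u hu heu (this ▸ (hRmem d hd.1).1)
  obtain ⟨heP, he1, he2, he3, he4⟩ := hRmem e he.1
  have k1 := hde' a ha he1
  have k2 := hde' (-a) hna he2
  have k3 := hde' b hb he3
  have k4 := hde' (-b) hnb he4
  have k5 : d + e ≠ -c := by
    intro h
    exact hadd d (hRmem d hd.1).1 e heP hde (h ▸ hneg c (hRmem c hc.1).1)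
  have ta := neg_eq_V a
  have tb := neg_eq_V b
  have tc := neg_eq_V c
  have e1 : d - e = (d - c) - (e - c) := by abel
  have e2 : d + e = (d - c) + (e - c) + (c + c) := by abel
  rw [← tc] at e2
  rw [e1] at k1 k2 k3 k4
  rw [e2] at k5
  have hde0 : (d - c) - (e - c) ≠ 0 := by rw [← e1]; exact sub_ne_zero.mpr hde
  have a3 : a + a = -a := ta.symm
  have b3 : b + b = -b := tb.symm
  rcases hdiff d hd.1 c hc.1 (Ne.symm hcd) (hd.2.trans hc.2.symm) with h | h | h | h <;>
  rcases hdiff e he.1 c hc.1 (Ne.symm hce) (he.2.trans hc.2.symm) with h' | h' | h' | h' <;>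
  rw [h, h'] at k1 k2 k3 k4 k5 hde0
  · exact hde0 (by abel)
  · exact k4 (Eq.trans (by abel) b3)
  · exact k2 (Eq.trans (by abel) a3)
  · exact k5 (by abel)
  · exact k3 (by rw [show a - b - (a + b) = -(b + b) by abel, b3, neg_neg])
  · exact hde0 (by abel)
  · exact k5 (by abel)
  · exact k2 (Eq.trans (by abel) a3)
  · exact k1 (by rw [show -a + b - (a + b) = -(a + a) by abel, a3, neg_neg])
  · exact k5 (by abel)
  · exact hde0 (by abel)
  · exact k4 (Eq.trans (by abel) b3)
  · exact k5 (by abel)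
  · exact k1 (by rw [show -a - b - (a - b) = -(a + a) by abel, a3, neg_neg])
  · exact k3 (by rw [show -a - b - (-a + b) = -(b + b) by abel, b3, neg_neg])
  · exact hde0 (by abel)

lemma upper_aux (S : Multiset V34) (hS : ¬ HasWZSS S 3) : Multiset.card S ≤ 20 := by
  classical
  have hno : ∀ t₁ t₂ : Multiset V34, t₁ + t₂ ≤ S → Multiset.card (t₁ + t₂) = 3 →
      t₁.sum ≠ t₂.sum := fun t₁ t₂ h1 h2 h3 => hS ⟨t₁, t₂, h1, h2, h3⟩
  have hdist : ∀ x ∈ S, ∀ y ∈ S, ∀ z ∈ S, x ≠ y → x ≠ z → y ≠ z →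
      x + y + z ≠ 0 ∧ x + y ≠ z ∧ x + z ≠ y ∧ y + z ≠ x := by
    intro x hx y hy z hz hxy hxz hyz
    have hle : ({x, y, z} : Multiset V34) ≤ S := by
      rw [Multiset.le_iff_subset (by simp [hxy, hxz, hyz])]
      intro w hw
      simp at hw
      rcases hw with rfl | rfl | rfl <;> assumption
    have hp1 : ({x, y} + {z} : Multiset V34) = {x, y, z} := rfl
    have hp2 : ({x, z} + {y} : Multiset V34) = {x, y, z} := by
      show x ::ₘ z ::ₘ {y} = x ::ₘ y ::ₘ {z}
      exact congrArg (x ::ₘ ·) (Multiset.pair_comm z y)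
    have hp3 : ({y, z} + {x} : Multiset V34) = {x, y, z} := by
      rw [add_comm]; rfl
    refine ⟨?_, ?_, ?_, ?_⟩
    · have := hno {x, y, z} 0 (by simpa using hle) (by simp)
      simpa [add_assoc] using this
    · simpa using hno {x, y} {z} (by rw [hp1]; exact hle) (by simp)
    · simpa using hno {x, z} {y} (by rw [hp2]; exact hle) (by simp)
    · simpa using hno {y, z} {x} (by rw [hp3]; exact hle) (by simp)
  -- multiplicity bounds
  have hrep : ∀ v : V34, v ≠ -v → ∀ i j, i ≤ S.count v → j ≤ S.count (-v) →
      Multiset.replicate i v + Multiset.replicate j (-v) ≤ S := by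
    intro v hv i j hi hj
    rw [Multiset.le_iff_count]
    intro w
    rw [Multiset.count_add, Multiset.count_replicate, Multiset.count_replicate]
    by_cases h1 : v = w
    · subst h1
      simp [Ne.symm hv, hi]
    · by_cases h2 : -v = w
      · subst h2
        simp [hv, hj]
      · simp [h1, h2]
  have hnn : ∀ v : V34, v ≠ 0 → v ≠ -v := fun v hv h => hv (zero_of_eq_neg v h)
  have hmult : ∀ v : V34, v ≠ 0 → S.count v + S.count (-v) ≤ 2 := by
    intro v hv
    by_contra hgt
    push Not at hgt
    obtain ⟨i, j, hi, hj, hij⟩ : ∃ i j, i ≤ S.count v ∧ j ≤ S.count (-v) ∧ i + j = 3 := by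
      refine ⟨min 3 (S.count v), 3 - min 3 (S.count v), ?_, ?_, ?_⟩ <;> omega
    refine hno _ _ (hrep v (hnn v hv) i j hi hj) (by simp [hij]) ?_
    simp only [Multiset.sum_replicate, smul_neg]
    rw [eq_neg_iff_add_eq_zero, ← add_smul, hij]
    have := three_mul_V v
    rw [← this]; abel
  let P : Finset V34 := Finset.univ.filter fun v => v ≠ 0 ∧ (v ∈ S ∨ -v ∈ S)
  have hPmem : ∀ v, v ∈ P ↔ v ≠ 0 ∧ (v ∈ S ∨ -v ∈ S) := by intro v; simp [P]
  have hP0 : (0 : V34) ∉ P := by simp [hPmem]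
  have hPneg : ∀ v ∈ P, -v ∈ P := by
    intro v hv
    rw [hPmem] at hv ⊢
    exact ⟨neg_ne_zero.mpr hv.1, by rw [neg_neg]; exact hv.2.symm⟩
  have hP : P.card ≤ 20 := by
    refine cap_bound P hP0 hPneg ?_
    intro a ha b hb hab hc
    rw [hPmem] at ha hb hc
    obtain ⟨ha0, ha⟩ := ha
    obtain ⟨hb0, hb⟩ := hb
    obtain ⟨hc0, hc⟩ := hc
    have hc1 : a + b ≠ a := by simpa using hb0
    have hc2 : a + b ≠ b := by simpa using ha0
    have hab' : a ≠ -b := fun h => hc0 (by rw [h]; simp)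
    have hc3 : a + b ≠ -a := by
      rw [neg_eq_V a]; intro h; exact hab (add_left_cancel h).symm
    have hc4 : a + b ≠ -b := by
      rw [neg_eq_V b]; intro h; exact hab (add_right_cancel h)
    have flip : ∀ x y : V34, x ≠ -y → -x ≠ y := fun x y h h' => h (by rw [← h', neg_neg])
    have hab'' := flip _ _ hab'
    have hc3' := flip _ _ hc3
    have hc4' := flip _ _ hc4
    have n1 : -a ≠ -b := fun h => hab (neg_injective h)
    have n2 : -(a + b) ≠ -a := fun h => hc1 (neg_injective h)
    have n3 : -(a + b) ≠ -b := fun h => hc2 (neg_injective h)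
    rcases ha with ha | ha <;> rcases hb with hb | hb <;> rcases hc with hc | hc
    · exact (hdist _ ha _ hb _ hc hab hc1.symm hc2.symm).2.1 rfl
    · exact (hdist _ ha _ hb _ hc hab hc3'.symm hc4'.symm).1 (by abel)
    · exact (hdist _ ha _ hb _ hc hab' hc1.symm hc4.symm).2.2.2 (by abel)
    · exact (hdist _ ha _ hb _ hc hab' hc3'.symm n3.symm).2.2.1 (by abel)
    · exact (hdist _ ha _ hb _ hc hab'' hc3.symm hc2.symm).2.2.1 (by abel)
    · exact (hdist _ ha _ hb _ hc hab'' n2.symm hc4'.symm).2.2.2 (by abel)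
    · exact (hdist _ ha _ hb _ hc n1 hc3.symm hc4.symm).1 (by abel)
    · exact (hdist _ ha _ hb _ hc n1 n2.symm n3.symm).2.1 (by abel)
  -- counting
  have hsum1 : ∑ v : V34, S.count v = Multiset.card S :=
    Multiset.sum_count_eq_card (fun _ _ => Finset.mem_univ _)
  have hsum2 : ∑ v : V34, S.count (-v) = Multiset.card S := by
    rw [← hsum1]
    exact Equiv.sum_comp (Equiv.neg V34) (fun v => S.count v)
  have hsum : ∑ v : V34, (S.count v + S.count (-v)) = 2 * Multiset.card S := by
    rw [Finset.sum_add_distrib, hsum1, hsum2]; ring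
  have hsplit : ∑ v : V34, (S.count v + S.count (-v)) =
      2 * S.count 0 + ∑ v ∈ P, (S.count v + S.count (-v)) := by
    rw [← Finset.add_sum_erase _ _ (Finset.mem_univ (0 : V34))]
    refine congrArg₂ (· + ·) ?_ ?_
    · rw [neg_zero, two_mul]
    · symm
      apply Finset.sum_subset
      · intro v hv
        simp [((hPmem v).mp hv).1]
      · intro v hv hvP
        have hv0 : v ≠ 0 := (Finset.mem_erase.mp hv).1
        have : ¬ (v ∈ S ∨ -v ∈ S) := fun h => hvP ((hPmem v).mpr ⟨hv0, h⟩)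
        push Not at this
        simp [this.1, this.2]
  by_cases hz : (0 : V34) ∈ S
  · have hz2 : S.count 0 ≤ 2 := by
      by_contra h
      push Not at h
      refine hno (Multiset.replicate 3 0) 0 ?_ (by simp) (by simp)
      rw [add_zero]
      exact Multiset.le_count_iff_replicate_le.mp h
    have hzero : ∀ t : Multiset V34, (0 : V34) ∉ t → t ≤ S → {0} + t ≤ S := by
      intro t h0t ht
      rw [Multiset.singleton_add]
      exact (Multiset.cons_le_of_notMem h0t).mpr ⟨hz, ht⟩
    have hm1 : ∀ v ∈ P, S.count v + S.count (-v) ≤ 1 := by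
      intro v hv
      have hv0 := ((hPmem v).mp hv).1
      by_contra hgt
      push Not at hgt
      have hr := hrep v (hnn v hv0)
      have : 2 ≤ S.count v ∨ 2 ≤ S.count (-v) ∨ (1 ≤ S.count v ∧ 1 ≤ S.count (-v)) := by omega
      rcases this with h | h | ⟨h, h'⟩
      · refine hno ({0} + {v}) {v} ?_ (by simp) (by simp)
        rw [add_assoc]
        refine hzero _ (by simp [hv0, hv0.symm]) ?_
        exact Multiset.le_count_iff_replicate_le.mp h
      · refine hno ({0} + {-v}) {-v} ?_ (by simp) (by simp)
        rw [add_assoc]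
        refine hzero _ (by simp [hv0, hv0.symm]) ?_
        exact Multiset.le_count_iff_replicate_le.mp h
      · refine hno {0} ({v} + {-v}) ?_ (by simp) (by simp)
        refine hzero _ (by simp [hv0, hv0.symm]) ?_
        exact hr 1 1 h h'
    have := Finset.sum_le_card_nsmul P _ 1 hm1
    simp only [smul_eq_mul] at this
    omega
  · have hz0 : S.count 0 = 0 := Multiset.count_eq_zero.mpr hz
    have := Finset.sum_le_card_nsmul P _ 2 (fun v hv => hmult v ((hPmem v).mp hv).1)
    simp only [smul_eq_mul] at this
    omega

/-- The elliptic quadric with ten points. -/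
def capList : List V34 :=
  [![0,0,0,1], ![0,0,1,0], ![1,0,1,2], ![2,0,1,2], ![0,1,1,2], ![0,2,1,2],
   ![1,1,1,1], ![1,2,1,1], ![2,1,1,1], ![2,2,1,1]]

/-- The quadratic form that vanishes on `capList`. -/
def capForm (v : V34) : ZMod 3 := v 0 * v 0 + v 1 * v 1 + v 2 * v 3

lemma capForm_zero : ∀ x ∈ capList, capForm x = 0 := by decide +kernel

lemma capForm_add : ∀ x ∈ capList, ∀ y ∈ capList, capForm (x + y) = 0 → x = y := by
  decide +kernel

lemma cap_double : ∀ x ∈ capList, x + x ∉ capList := by decide +kernel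

lemma capForm_neg (v : V34) : capForm (-v) = capForm v := by simp [capForm]

lemma cap_add : ∀ x ∈ capList, ∀ y ∈ capList, ∀ z ∈ capList, x + y ≠ z := by
  intro x hx y hy z hz h
  obtain rfl := capForm_add x hx y hy (by rw [h]; exact capForm_zero z hz)
  exact cap_double x hx (h ▸ hz)

lemma cap_sum : ∀ x ∈ capList, ∀ y ∈ capList, ∀ z ∈ capList, x + y + z = 0 → x = y ∧ y = z := by
  intro x hx y hy z hz h
  have h1 : x + y = -z := eq_neg_of_add_eq_zero_left h
  obtain rfl := capForm_add x hx y hy (by rw [h1, capForm_neg]; exact capForm_zero z hz)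
  refine ⟨rfl, ?_⟩
  rw [← neg_eq_V] at h1
  exact neg_injective h1

lemma cap_nodup : capList.Nodup := by decide +kernel

lemma lower_aux : ¬ HasWZSS ((capList : Multiset V34) + (capList : Multiset V34)) 3 := by
  classical
  rintro ⟨t₁, t₂, hle, hc, hs⟩
  have hmem : ∀ x ∈ t₁ + t₂, x ∈ capList := by
    intro x hx
    have := Multiset.mem_of_le hle hx
    simpa using this
  have hcount : ∀ x, Multiset.count x (t₁ + t₂) ≤ 2 := by
    intro x
    have h1 := Multiset.count_le_of_le x hle
    have h2 : Multiset.count x (capList : Multiset V34) ≤ 1 :=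
      Multiset.nodup_iff_count_le_one.mp (Multiset.coe_nodup.mpr cap_nodup) x
    rw [Multiset.count_add (s := (capList : Multiset V34))] at h1
    omega
  have main : ∀ s₁ s₂ : Multiset V34, (∀ x ∈ s₁ + s₂, x ∈ capList) →
      (∀ x, Multiset.count x (s₁ + s₂) ≤ 2) → s₁.sum = s₂.sum →
      Multiset.card s₁ + Multiset.card s₂ = 3 → Multiset.card s₂ ≤ 1 → False := by
    intro s₁ s₂ hm hk hsum hcard h2
    have h2' : Multiset.card s₂ = 0 ∨ Multiset.card s₂ = 1 := by omega
    rcases h2' with h | h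
    · have h1 : Multiset.card s₁ = 3 := by omega
      obtain ⟨x, y, z, rfl⟩ := Multiset.card_eq_three.mp h1
      obtain rfl := Multiset.card_eq_zero.mp h
      have hx : x + y + z = 0 := by simpa [add_assoc] using hsum
      obtain ⟨rfl, rfl⟩ := cap_sum x (hm x (by simp)) y (hm y (by simp)) z (hm z (by simp)) hx
      have := hk x
      simp at this
    · have h1 : Multiset.card s₁ = 2 := by omega
      obtain ⟨x, y, rfl⟩ := Multiset.card_eq_two.mp h1
      obtain ⟨z, rfl⟩ := Multiset.card_eq_one.mp h
      exact cap_add x (hm x (by simp)) y (hm y (by simp)) z (hm z (by simp)) (by simpa using hsum)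
  rw [Multiset.card_add] at hc
  by_cases h2 : Multiset.card t₂ ≤ 1
  · exact main t₁ t₂ hmem hcount hs hc h2
  · refine main t₂ t₁ ?_ ?_ hs.symm (by omega) (by omega)
    · rw [add_comm]; exact hmem
    · rw [add_comm]; exact hcount

lemma exp_V : AddMonoid.exponent V34 = 3 := by
  have hd : AddMonoid.exponent V34 ∣ 3 := by
    apply AddMonoid.exponent_dvd_of_forall_nsmul_eq_zero
    intro g
    have := three_mul_V g
    rw [← this]; abel
  rcases (Nat.dvd_prime Nat.prime_three).mp hd with h | h
  · rw [AddMonoid.exp_eq_one_iff] at h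
    exact absurd h (not_subsingleton _)
  · exact h

/-- `s_A(C_3^4) = 21`; that is, every sequence over `C_3^4` of length
at least `21` has a `{-1,1}`-zero-sum subsequence of length `3`, and there is a sequence
of length `20` with no such subsequence. -/
theorem sA_three_fourth :
    sA (Fin 4 → ZMod 3) = 21 ∧
    (∀ S : Multiset (Fin 4 → ZMod 3), 21 ≤ Multiset.card S → HasWZSS S 3) ∧
    ∃ S : Multiset (Fin 4 → ZMod 3), Multiset.card S = 20 ∧ ¬ HasWZSS S 3 := by
  have hup : ∀ S : Multiset (Fin 4 → ZMod 3), 21 ≤ Multiset.card S → HasWZSS S 3 := by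
    intro S hS
    by_contra h
    have := upper_aux S h
    omega
  have hcard : Multiset.card ((capList : Multiset V34) + (capList : Multiset V34)) = 20 := by
    simp [capList]
  refine ⟨?_, hup, _, hcard, lower_aux⟩
  have hexp : AddMonoid.exponent (Fin 4 → ZMod 3) = 3 := exp_V
  unfold sA
  rw [hexp]
  apply le_antisymm
  · exact Nat.sInf_le hup
  · refine le_csInf ⟨21, hup⟩ ?_
    intro l hl
    by_contra hlt
    push Not at hlt
    exact lower_aux (hl _ (by rw [hcard]; omega))
end

section
/- Let A = {−1,1}. Then 41 ≤ s_A(C_3^5) ≤ 45; that is, every sequence over C_3^5 of length at least 45 has an A-zero-sum subsequence of length 3, and there exists a sequence over C_3^5 of length 40 with no A-zero-sum subsequence of length 3. -/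
namespace CapSearch

/-- Forces the evaluation of a natural number before it is passed on. -/
def force (n : Nat) (k : Nat → Bool) : Bool :=
  Nat.rec (k 0) (fun m _ => k (Nat.shiftRight (Nat.succ m) 64))
    (Nat.lor (Nat.shiftLeft n 64) (Nat.mod n 18446744073709551557))

/-- Moves the bits in `L` up by `s` and those in `H` down by `t`. -/
def sh (L H s t m : Nat) : Nat :=
  Nat.lor (Nat.shiftLeft (Nat.land m L) s) (Nat.shiftRight (Nat.land m H) t)

/-- Translation by the basis vector `e_k` (`u`) and by its negative (`d`). -/
def u0 (m : Nat) : Nat :=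
  sh 6057761364954460558571305716832863482837087646430693570702649833003267803
    8077015153272614078095074289110484643782783528574258094270199777337690404 1 2 m
def d0 (m : Nat) : Nat :=
  sh 2019253788318153519523768572277621160945695882143564523567549944334422601
    12115522729908921117142611433665726965674175292861387141405299666006535606 2 1 m
def u1 (m : Nat) : Nat :=
  sh 1742643680329365366164348219910823741638066309247185821708981458809159231
    12392132837897709270502031786032524384981804865757765843263868151531798976 3 6 m
def d1 (m : Nat) : Nat :=
  sh 193627075592151707351594246656758193515340701027465091300997939867684359
    13941149442634922929314785759286589933104530473977486573671851670473273848 6 3 m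
def u2 (m : Nat) : Nat :=
  sh 27606880280557873152475863742633691807018255415913302155019937980350463
    14107169637946516763513904142200714434812852919589038362817829672360607744 9 18 m
def d2 (m : Nat) : Nat :=
  sh 53814581443582598737769714897921426524402057340961602641364401521151
    14134722703645631054067642236228450205193346772947610703370208245939437056 18 9 m
def u3 (m : Nat) : Nat :=
  sh 105312291668557180851911521916201725384276669995745569037071941631
    14134776412914782968109199154031826210418145790728281669227280573269016576 27 54 m
def d3 (m : Nat) : Nat :=
  sh 784637711077328546155862329604770211722749905832079523839
    14134776518227073852028668928614801970757541570234739942222943778261434368 54 27 m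
def u4 (m : Nat) : Nat :=
  sh 5846006549323611672814739330865132078623730171903
    14134776518227074636666374159936798803008198360265620799840770986610786304 81 162 m
def d4 (m : Nat) : Nat :=
  sh 2417851639229258349412351
    14134776518227074636666380005943348126619871175002533813333620351991545856 162 81 m

/-- A position in a block of nine points, with the translations by plus and minus it. -/
structure Pt where
  x : Nat
  nx : Nat
  f : Nat → Nat
  g : Nat → Nat

/-- A possible intersection with a block. -/
structure Opt where
  o : Nat
  no : Nat
  d : Nat
  ps : List Pt

def p0 : Pt := ⟨0, 0, fun m => m, fun m => m⟩
def p1 : Pt := ⟨1, 2, fun m => u0 m, fun m => d0 m⟩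
def p2 : Pt := ⟨2, 1, fun m => d0 m, fun m => u0 m⟩
def p3 : Pt := ⟨3, 6, fun m => u1 m, fun m => d1 m⟩
def p4 : Pt := ⟨4, 8, fun m => u1 (u0 m), fun m => d1 (d0 m)⟩
def p5 : Pt := ⟨5, 7, fun m => u1 (d0 m), fun m => d1 (u0 m)⟩
def p6 : Pt := ⟨6, 3, fun m => d1 m, fun m => u1 m⟩
def p7 : Pt := ⟨7, 5, fun m => d1 (u0 m), fun m => u1 (d0 m)⟩
def p8 : Pt := ⟨8, 4, fun m => d1 (d0 m), fun m => u1 (u0 m)⟩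

def opts : List Opt :=
  [⟨17, 257, 0, [p0, p4]⟩,
   ⟨33, 129, 0, [p0, p5]⟩,
   ⟨129, 33, 0, [p0, p7]⟩,
   ⟨257, 17, 0, [p0, p8]⟩,
   ⟨10, 68, 0, [p1, p3]⟩,
   ⟨34, 132, 0, [p1, p5]⟩,
   ⟨66, 12, 0, [p1, p6]⟩,
   ⟨258, 20, 0, [p1, p8]⟩,
   ⟨12, 66, 0, [p2, p3]⟩,
   ⟨20, 258, 0, [p2, p4]⟩,
   ⟨68, 10, 0, [p2, p6]⟩,
   ⟨132, 34, 0, [p2, p7]⟩,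
   ⟨136, 96, 0, [p3, p7]⟩,
   ⟨264, 80, 0, [p3, p8]⟩,
   ⟨80, 264, 0, [p4, p6]⟩,
   ⟨272, 272, 0, [p4, p8]⟩,
   ⟨96, 136, 0, [p5, p6]⟩,
   ⟨160, 160, 0, [p5, p7]⟩,
   ⟨1, 1, 1, [p0]⟩,
   ⟨2, 4, 1, [p1]⟩,
   ⟨4, 2, 1, [p2]⟩,
   ⟨8, 64, 1, [p3]⟩,
   ⟨16, 256, 1, [p4]⟩,
   ⟨32, 128, 1, [p5]⟩,
   ⟨64, 8, 1, [p6]⟩,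
   ⟨128, 32, 1, [p7]⟩,
   ⟨256, 16, 1, [p8]⟩,
   ⟨0, 0, 2, []⟩]

def opt04 : List Opt :=
  [⟨17, 257, 0, [p0, p4]⟩]

/-- Two bits per 9-bit mask: a lower bound for the deficit of a block. -/
def lossTable : Nat :=
  528294531135665246352339784916516606520399844128422231063109688515136405111986307932151574694078445017484734102525393748260519103555530488862476329639955769334837205199370127392802364287618406749481763981388664383780616342244524437021942900518908669144096114575923303766

/-- A block: its index, that of its negative, the two translations, the possible intersections. -/
structure Blk where
  v : Nat
  nv : Nat
  f : Nat → Nat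
  g : Nat → Nat
  os : List Opt

def blockMask (C v : Nat) : Nat := Nat.land (Nat.shiftRight C (Nat.mul 9 v)) 511

def loss (m : Nat) : Nat := Nat.land (Nat.shiftRight lossTable (Nat.mul 2 m)) 3

def bound (bl : List Blk) (C : Nat) : Nat :=
  List.rec 0 (fun b _ ih => Nat.add (loss (blockMask C b.v)) ih) bl

def kill (A B : Nat) (ps : List Pt) : Nat :=
  List.rec 0 (fun p _ ih => Nat.lor (Nat.lor (p.f A) (p.g B)) ih) ps

def remove (C K : Nat) : Nat := Nat.xor C (Nat.land C K)

def addBlock (S v nv o no : Nat) : Nat :=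
  Nat.lor S (Nat.lor (Nat.shiftLeft o (Nat.mul 9 v)) (Nat.shiftLeft no (Nat.mul 9 nv)))

def tryOpts (b : Blk) (next : Nat → Nat → Nat → Bool) (S C D m A B : Nat) (os : List Opt) : Bool :=
  List.rec true (fun o _ ih =>
    Bool.rec ih (Bool.rec ih
      (Bool.rec false ih (force (addBlock S b.v b.nv o.o o.no) fun S' =>
        force (remove C (kill A B o.ps)) fun C' => force (Nat.sub D o.d) fun D' => next S' C' D'))
      (Nat.ble o.d D)) (Nat.beq (Nat.land m o.o) o.o)) os

/-- `true` means: no cap is compatible with the given data. -/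
def search (bl : List Blk) : Nat → Nat → Nat → Bool :=
  List.rec (fun _ _ _ => false) (fun b bs next S C D =>
    Bool.rec true (Bool.rec false (Bool.rec false
        (force (blockMask C b.v) fun m => force (b.f S) fun A => force (b.g S) fun B =>
          tryOpts b next S C D m A B b.os)
         (Nat.beq (blockMask S b.nv) 0)) (Nat.beq (blockMask S b.v) 0))
      (Nat.ble (bound (b :: bs) C) D)) bl

def blocks : List Blk :=
  [⟨1, 2, fun m => u2 m, fun m => d2 m, opt04⟩,
   ⟨3, 6, fun m => u3 m, fun m => d3 m, opt04⟩,
   ⟨9, 18, fun m => u4 m, fun m => d4 m, opt04⟩,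
   ⟨4, 8, fun m => u3 (u2 m), fun m => d3 (d2 m), opts⟩,
   ⟨10, 20, fun m => u4 (u2 m), fun m => d4 (d2 m), opts⟩,
   ⟨12, 24, fun m => u4 (u3 m), fun m => d4 (d3 m), opts⟩,
   ⟨7, 5, fun m => d3 (u2 m), fun m => u3 (d2 m), opts⟩,
   ⟨19, 11, fun m => d4 (u2 m), fun m => u4 (d2 m), opts⟩,
   ⟨21, 15, fun m => d4 (u3 m), fun m => u4 (d3 m), opts⟩,
   ⟨13, 26, fun m => u4 (u3 (u2 m)), fun m => d4 (d3 (d2 m)), opts⟩,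
   ⟨22, 17, fun m => d4 (u3 (u2 m)), fun m => u4 (d3 (d2 m)), opts⟩,
   ⟨16, 23, fun m => u4 (d3 (u2 m)), fun m => d4 (u3 (d2 m)), opts⟩,
   ⟨14, 25, fun m => u4 (u3 (d2 m)), fun m => d4 (d3 (u2 m)), opts⟩]

def S0 : Nat := 78

def C0 : Nat := 14134776518227074636666380005943348126619871175004951664972849610340958207

/-- The ambient space. -/
abbrev V := Fin 5 → ZMod 3

/-- The vector with base-three index `i`. -/
def vec (i : Nat) : V := fun k => ((i / 3 ^ k.val : Nat) : ZMod 3)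

theorem force_eq (n : Nat) (k : Nat → Bool) : force n k = k n := by
  have key : Nat.shiftRight (Nat.lor (Nat.shiftLeft n 64) (Nat.mod n 18446744073709551557)) 64
      = n := by
    change ((n <<< 64) ||| (n % 18446744073709551557)) >>> 64 = n
    rw [Nat.shiftRight_or_distrib, Nat.shiftLeft_shiftRight]
    have h : (n % 18446744073709551557) >>> 64 = 0 := by
      rw [Nat.shiftRight_eq_div_pow]
      apply Nat.div_eq_of_lt
      exact lt_trans (Nat.mod_lt _ (by norm_num)) (by norm_num)
    rw [h, Nat.or_zero]
  unfold force
  generalize Nat.lor (Nat.shiftLeft n 64) (Nat.mod n 18446744073709551557) = t at key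
  cases t with
  | zero =>
    have : n = 0 := by rw [← key]; decide
    subst this; rfl
  | succ m =>
    change k (Nat.shiftRight (Nat.succ m) 64) = k n
    rw [key]

/-- The result only has bits which are translates by `u` of bits of `m`. -/
def Tr (u : V) (f : Nat → Nat) : Prop :=
  ∀ m i, (f m).testBit i = true → ∃ j, m.testBit j = true ∧ vec i = vec j + u

theorem Tr.id : Tr 0 (fun m => m) := fun m i h => ⟨i, h, by simp⟩

theorem Tr.comp {u u' : V} {f f' : Nat → Nat} (h : Tr u f) (h' : Tr u' f') :
    Tr (u + u') (fun m => f' (f m)) := by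
  intro m i hi
  obtain ⟨j, hj, e⟩ := h' _ _ hi
  obtain ⟨k, hk, e'⟩ := h _ _ hj
  exact ⟨k, hk, by rw [e, e', add_assoc]⟩

theorem Tr.sh {L H s t : Nat} {u : V} (hL : L < 2 ^ 243) (hH : H < 2 ^ 243)
    (h1 : ∀ j < 243, L.testBit j = true → vec (j + s) = vec j + u)
    (h2 : ∀ j < 243, H.testBit j = true → vec (j - t) = vec j + u) :
    Tr u (sh L H s t) := by
  intro m i hi
  have lt_of : ∀ {M j : Nat}, M < 2 ^ 243 → M.testBit j = true → j < 243 := by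
    intro M j hM hj
    by_contra hlt
    have := Nat.testBit_lt_two_pow (lt_of_lt_of_le hM (Nat.pow_le_pow_right (n := 2) (by norm_num)
      (not_lt.mp hlt)))
    simp [this] at hj
  change (((m &&& L) <<< s) ||| ((m &&& H) >>> t)).testBit i = true at hi
  rw [Nat.testBit_or, Bool.or_eq_true, Nat.testBit_shiftLeft, Nat.testBit_shiftRight,
    Nat.testBit_and, Nat.testBit_and] at hi
  simp only [Bool.and_eq_true, decide_eq_true_eq] at hi
  rcases hi with ⟨hs, hm, hl⟩ | ⟨hm, hh⟩
  · refine ⟨i - s, hm, ?_⟩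
    have := h1 _ (lt_of hL hl) hl
    rwa [Nat.sub_add_cancel hs] at this
  · refine ⟨t + i, hm, ?_⟩
    have := h2 _ (lt_of hH hh) hh
    rwa [Nat.add_sub_cancel_left] at this

theorem tr_u0 : Tr (vec 1) u0 :=
  Tr.sh (by norm_num) (by norm_num) (by decide +kernel) (by decide +kernel)
theorem tr_u1 : Tr (vec 3) u1 :=
  Tr.sh (by norm_num) (by norm_num) (by decide +kernel) (by decide +kernel)
theorem tr_u2 : Tr (vec 9) u2 :=
  Tr.sh (by norm_num) (by norm_num) (by decide +kernel) (by decide +kernel)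
theorem tr_u3 : Tr (vec 27) u3 :=
  Tr.sh (by norm_num) (by norm_num) (by decide +kernel) (by decide +kernel)
theorem tr_u4 : Tr (vec 81) u4 :=
  Tr.sh (by norm_num) (by norm_num) (by decide +kernel) (by decide +kernel)
theorem tr_d0 : Tr (vec 2) d0 :=
  Tr.sh (by norm_num) (by norm_num) (by decide +kernel) (by decide +kernel)
theorem tr_d1 : Tr (vec 6) d1 :=
  Tr.sh (by norm_num) (by norm_num) (by decide +kernel) (by decide +kernel)
theorem tr_d2 : Tr (vec 18) d2 :=
  Tr.sh (by norm_num) (by norm_num) (by decide +kernel) (by decide +kernel)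
theorem tr_d3 : Tr (vec 54) d3 :=
  Tr.sh (by norm_num) (by norm_num) (by decide +kernel) (by decide +kernel)
theorem tr_d4 : Tr (vec 162) d4 :=
  Tr.sh (by norm_num) (by norm_num) (by decide +kernel) (by decide +kernel)

theorem Tr.cast {u u' : V} {f : Nat → Nat} (h : Tr u f) (e : u = u') : Tr u' f := e ▸ h

/-- A point whose translations are right. -/
def Pt.Good (p : Pt) : Prop :=
  p.x < 9 ∧ p.nx < 9 ∧ Tr (vec p.x) p.f ∧ Tr (-vec p.x) p.g ∧ vec p.nx = -vec p.x

theorem good_p0 : p0.Good := ⟨by decide, by decide, Tr.id.cast (by decide +kernel),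
  Tr.id.cast (by decide +kernel), by decide +kernel⟩
theorem good_p1 : p1.Good := ⟨by decide, by decide, tr_u0.cast (by decide +kernel),
  tr_d0.cast (by decide +kernel), by decide +kernel⟩
theorem good_p2 : p2.Good := ⟨by decide, by decide, tr_d0.cast (by decide +kernel),
  tr_u0.cast (by decide +kernel), by decide +kernel⟩
theorem good_p3 : p3.Good := ⟨by decide, by decide, tr_u1.cast (by decide +kernel),
  tr_d1.cast (by decide +kernel), by decide +kernel⟩
theorem good_p4 : p4.Good := ⟨by decide, by decide, (tr_u0.comp tr_u1).cast (by decide +kernel),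
  (tr_d0.comp tr_d1).cast (by decide +kernel), by decide +kernel⟩
theorem good_p5 : p5.Good := ⟨by decide, by decide, (tr_d0.comp tr_u1).cast (by decide +kernel),
  (tr_u0.comp tr_d1).cast (by decide +kernel), by decide +kernel⟩
theorem good_p6 : p6.Good := ⟨by decide, by decide, tr_d1.cast (by decide +kernel),
  tr_u1.cast (by decide +kernel), by decide +kernel⟩
theorem good_p7 : p7.Good := ⟨by decide, by decide, (tr_u0.comp tr_d1).cast (by decide +kernel),
  (tr_d0.comp tr_u1).cast (by decide +kernel), by decide +kernel⟩
theorem good_p8 : p8.Good := ⟨by decide, by decide, (tr_d0.comp tr_d1).cast (by decide +kernel),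
  (tr_u0.comp tr_u1).cast (by decide +kernel), by decide +kernel⟩

/-- An option whose data are consistent. -/
def Opt.Good (o : Opt) : Prop :=
  (∀ p ∈ o.ps, p.Good) ∧ o.o < 512 ∧ (∀ p ∈ o.ps, o.o.testBit p.x = true) ∧
  (∀ x, o.no.testBit x = true → ∃ y, o.o.testBit y = true ∧ y < 9 ∧ vec x = - vec y ∧ x < 9) ∧
  (∀ m < 512, Nat.land m o.o = o.o → loss m ≤ o.d)

theorem opts_ps : ∀ o ∈ opts, ∀ p ∈ o.ps, p.Good := by
  simp [opts, good_p0, good_p1, good_p2, good_p3, good_p4, good_p5, good_p6, good_p7, good_p8]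

theorem opts_bits : ∀ o ∈ opts, o.o < 512 ∧ o.no < 512 ∧
    (∀ p ∈ o.ps, o.o.testBit p.x = true) ∧
    (∀ x < 9, o.no.testBit x = true → ∃ y < 9, o.o.testBit y = true ∧ vec x = - vec y) := by
  decide +kernel

theorem opts_loss : ∀ o ∈ opts, ∀ m < 512, Nat.land m o.o = o.o → loss m ≤ o.d := by
  decide +kernel

theorem lt_nine {M x : Nat} (hM : M < 512) (h : M.testBit x = true) : x < 9 := by
  by_contra hlt
  have := Nat.testBit_lt_two_pow (lt_of_lt_of_le hM (Nat.pow_le_pow_right (n := 2) (by norm_num)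
      (not_lt.mp hlt) : 2 ^ 9 ≤ _))
  simp [this] at h

theorem opts_good : ∀ o ∈ opts, o.Good := by
  intro o ho
  obtain ⟨a, b, c, d⟩ := opts_bits o ho
  refine ⟨opts_ps o ho, a, c, ?_, opts_loss o ho⟩
  intro x hx
  have hx9 := lt_nine b hx
  obtain ⟨y, hy, e1, e2⟩ := d x hx9 hx
  exact ⟨y, e1, hy, e2, hx9⟩

/-- A block whose data are consistent. -/
def Blk.Good (b : Blk) : Prop :=
  b.v < 27 ∧ b.nv < 27 ∧ b.v ≠ 0 ∧ Tr (vec (9 * b.v)) b.f ∧ Tr (-vec (9 * b.v)) b.g ∧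
  vec (9 * b.nv) = -vec (9 * b.v) ∧ ∀ o ∈ b.os, o.Good

theorem opt04_good : ∀ o ∈ opt04, o.Good := by
  intro o ho
  refine opts_good o ?_
  have : o = ⟨17, 257, 0, [p0, p4]⟩ := by simpa [opt04] using ho
  subst this
  simp [opts]

theorem blocks_good : ∀ b ∈ blocks, b.Good := by
  simp only [blocks, List.forall_mem_cons, List.not_mem_nil, false_imp_iff, implies_true, and_true]
  have o1 := opts_good
  have o2 := opt04_good
  refine ⟨⟨by decide, by decide, by decide, ?_, ?_, by decide +kernel, o2⟩,
    ⟨by decide, by decide, by decide, ?_, ?_, by decide +kernel, o2⟩,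
    ⟨by decide, by decide, by decide, ?_, ?_, by decide +kernel, o2⟩,
    ⟨by decide, by decide, by decide, ?_, ?_, by decide +kernel, o1⟩,
    ⟨by decide, by decide, by decide, ?_, ?_, by decide +kernel, o1⟩,
    ⟨by decide, by decide, by decide, ?_, ?_, by decide +kernel, o1⟩,
    ⟨by decide, by decide, by decide, ?_, ?_, by decide +kernel, o1⟩,
    ⟨by decide, by decide, by decide, ?_, ?_, by decide +kernel, o1⟩,
    ⟨by decide, by decide, by decide, ?_, ?_, by decide +kernel, o1⟩,
    ⟨by decide, by decide, by decide, ?_, ?_, by decide +kernel, o1⟩,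
    ⟨by decide, by decide, by decide, ?_, ?_, by decide +kernel, o1⟩,
    ⟨by decide, by decide, by decide, ?_, ?_, by decide +kernel, o1⟩,
    ⟨by decide, by decide, by decide, ?_, ?_, by decide +kernel, o1⟩⟩
  · exact tr_u2.cast (by decide +kernel)
  · exact tr_d2.cast (by decide +kernel)
  · exact tr_u3.cast (by decide +kernel)
  · exact tr_d3.cast (by decide +kernel)
  · exact tr_u4.cast (by decide +kernel)
  · exact tr_d4.cast (by decide +kernel)
  · exact (tr_u2.comp tr_u3).cast (by decide +kernel)
  · exact (tr_d2.comp tr_d3).cast (by decide +kernel)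
  · exact (tr_u2.comp tr_u4).cast (by decide +kernel)
  · exact (tr_d2.comp tr_d4).cast (by decide +kernel)
  · exact (tr_u3.comp tr_u4).cast (by decide +kernel)
  · exact (tr_d3.comp tr_d4).cast (by decide +kernel)
  · exact (tr_u2.comp tr_d3).cast (by decide +kernel)
  · exact (tr_d2.comp tr_u3).cast (by decide +kernel)
  · exact (tr_u2.comp tr_d4).cast (by decide +kernel)
  · exact (tr_d2.comp tr_u4).cast (by decide +kernel)
  · exact (tr_u3.comp tr_d4).cast (by decide +kernel)
  · exact (tr_d3.comp tr_u4).cast (by decide +kernel)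
  · exact ((tr_u2.comp tr_u3).comp tr_u4).cast (by decide +kernel)
  · exact ((tr_d2.comp tr_d3).comp tr_d4).cast (by decide +kernel)
  · exact ((tr_u2.comp tr_u3).comp tr_d4).cast (by decide +kernel)
  · exact ((tr_d2.comp tr_d3).comp tr_u4).cast (by decide +kernel)
  · exact ((tr_u2.comp tr_d3).comp tr_u4).cast (by decide +kernel)
  · exact ((tr_d2.comp tr_u3).comp tr_d4).cast (by decide +kernel)
  · exact ((tr_d2.comp tr_u3).comp tr_u4).cast (by decide +kernel)
  · exact ((tr_u2.comp tr_d3).comp tr_d4).cast (by decide +kernel)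

theorem blockMask_testBit (C v x : Nat) :
    (blockMask C v).testBit x = (C.testBit (9 * v + x) && decide (x < 9)) := by
  change ((C >>> (9 * v)) &&& (2 ^ 9 - 1)).testBit x = _
  rw [Nat.testBit_and, Nat.testBit_shiftRight, Nat.testBit_two_pow_sub_one]

theorem blockMask_lt (C v : Nat) : blockMask C v < 512 := by
  change ((C >>> (9 * v)) &&& 511) < 512
  exact lt_of_le_of_lt Nat.and_le_right (by norm_num)

theorem vec_block : ∀ v < 27, ∀ x < 9, vec (9 * v + x) = vec (9 * v) + vec x := by
  decide +kernel

/-- Symmetric sets of nonzero vectors without three vectors that form a nontrivial zero sum. -/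
def IsCap (T : Finset V) : Prop :=
  0 ∉ T ∧ (∀ x ∈ T, -x ∈ T) ∧ ∀ x ∈ T, ∀ y ∈ T, x ≠ y → x ≠ -y → x + y ∉ T

/-- The option `o` describes the intersection of `T` with block `b`. -/
def Fits (T : Finset V) (dT : Nat → Nat) (b : Blk) (o : Opt) : Prop :=
  o.d = dT b.v ∧ ∀ x < 9, (vec (9 * b.v + x) ∈ T ↔ o.o.testBit x = true)

theorem land_eq_of_fits {T : Finset V} {dT : Nat → Nat} {b : Blk} {o : Opt} {C : Nat}
    (hb : b.Good) (ho : o.Good) (h : Fits T dT b o)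
    (hC : ∀ i < 243, vec i ∈ T → C.testBit i = true) :
    Nat.land (blockMask C b.v) o.o = o.o := by
  change (blockMask C b.v) &&& o.o = o.o
  apply Nat.eq_of_testBit_eq
  intro x
  rw [Nat.testBit_and]
  cases hx : o.o.testBit x with
  | false => simp
  | true =>
    have hx9 := lt_nine ho.2.1 hx
    have := hC (9 * b.v + x) (by have := hb.1; omega) ((h.2 x hx9).2 hx)
    rw [blockMask_testBit, this]
    simp [hx9]

theorem bound_le {T : Finset V} {dT : Nat → Nat} {C : Nat}
    (hC : ∀ i < 243, vec i ∈ T → C.testBit i = true) (bl : List Blk)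
    (hg : ∀ b ∈ bl, b.Good) (hf : ∀ b ∈ bl, ∃ o ∈ b.os, Fits T dT b o) :
    bound bl C ≤ (bl.map fun b => dT b.v).sum := by
  induction bl with
  | nil => exact le_refl 0
  | cons b bs ih =>
    have h1 := ih (fun c hc => hg c (List.mem_cons_of_mem _ hc))
      (fun c hc => hf c (List.mem_cons_of_mem _ hc))
    obtain ⟨o, ho, hfit⟩ := hf b (List.mem_cons_self)
    have hb := hg b (List.mem_cons_self)
    have hog := hb.2.2.2.2.2.2 o ho
    have h2 := hog.2.2.2.2 _ (blockMask_lt C b.v) (land_eq_of_fits hb hog hfit hC)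
    rw [List.map_cons, List.sum_cons, ← hfit.1]
    exact Nat.add_le_add h2 h1

theorem tryOpts_mem (b : Blk) (next : Nat → Nat → Nat → Bool) (S C D m A B : Nat) (os : List Opt)
    (h : tryOpts b next S C D m A B os = true) (o : Opt) (ho : o ∈ os)
    (h1 : Nat.land m o.o = o.o) (h2 : o.d ≤ D) :
    next (addBlock S b.v b.nv o.o o.no) (remove C (kill A B o.ps)) (D - o.d) = true := by
  induction os with
  | nil => simp at ho
  | cons a as ih =>
    have e : tryOpts b next S C D m A B (a :: as) =
      Bool.rec (tryOpts b next S C D m A B as) (Bool.rec (tryOpts b next S C D m A B as)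
      (Bool.rec false (tryOpts b next S C D m A B as)
        (force (addBlock S b.v b.nv a.o a.no) fun S' =>
        force (remove C (kill A B a.ps)) fun C' => force (Nat.sub D a.d) fun D' => next S' C' D'))
      (Nat.ble a.d D)) (Nat.beq (Nat.land m a.o) a.o) := rfl
    rw [e] at h
    simp only [force_eq] at h
    rcases List.mem_cons.1 ho with rfl | ho'
    · rw [h1] at h
      have e1 : Nat.beq o.o o.o = true := Nat.beq_refl _
      have e2 : Nat.ble o.d D = true := Nat.ble_eq_true_of_le h2
      rw [e1, e2] at h
      change Bool.rec false (tryOpts b next S C D m A B as) (next _ _ (D - o.d)) = true at h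
      cases hn : next (addBlock S b.v b.nv o.o o.no) (remove C (kill A B o.ps)) (D - o.d) with
      | true => rfl
      | false => rw [hn] at h; simp at h
    · apply ih _ ho'
      revert h
      cases Nat.beq (Nat.land m a.o) a.o <;> cases Nat.ble a.d D <;>
        cases next (addBlock S b.v b.nv a.o a.no) (remove C (kill A B a.ps)) (Nat.sub D a.d) <;>
        simp

theorem kill_mem (A B : Nat) (ps : List Pt) (i : Nat) (h : (kill A B ps).testBit i = true) :
    ∃ p ∈ ps, (p.f A).testBit i = true ∨ (p.g B).testBit i = true := by
  induction ps with
  | nil =>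
    change (0 : Nat).testBit i = true at h
    simp at h
  | cons p ps ih =>
    change ((p.f A ||| p.g B) ||| kill A B ps).testBit i = true at h
    rw [Nat.testBit_or, Nat.testBit_or, Bool.or_eq_true, Bool.or_eq_true] at h
    rcases h with h | h
    · exact ⟨p, List.mem_cons_self, h⟩
    · obtain ⟨q, hq, h'⟩ := ih h
      exact ⟨q, List.mem_cons_of_mem _ hq, h'⟩

theorem vec_surj : ∀ x : V, ∃ i < 243, vec i = x := by
  intro x
  refine ⟨(x 0).val + 3 * (x 1).val + 9 * (x 2).val + 27 * (x 3).val + 81 * (x 4).val, ?_, ?_⟩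
  · have h0 := (x 0).val_lt
    have h1 := (x 1).val_lt
    have h2 := (x 2).val_lt
    have h3 := (x 3).val_lt
    have h4 := (x 4).val_lt
    omega
  · have key : ∀ a b c d e : ZMod 3, vec (a.val + 3 * b.val + 9 * c.val + 27 * d.val + 81 * e.val)
        = ![a, b, c, d, e] := by decide +kernel
    rw [key]
    ext k
    fin_cases k <;> rfl

theorem vec_inj : ∀ i < 243, ∀ j < 243, vec i = vec j → i = j := by
  have key : ∀ i < 243, ((vec i 0).val + 3 * (vec i 1).val + 9 * (vec i 2).val
      + 27 * (vec i 3).val + 81 * (vec i 4).val) = i := by decide +kernel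
  intro i hi j hj h
  rw [← key i hi, ← key j hj, h]

theorem search_sound {T : Finset V} (hT : IsCap T) (dT : Nat → Nat) (bl : List Blk)
    (hg : ∀ b ∈ bl, b.Good) (hf : ∀ b ∈ bl, ∃ o ∈ b.os, Fits T dT b o) :
    ∀ S C D : Nat, S < 2 ^ 243 → (∀ i, S.testBit i = true → vec i ∈ T) →
    (∀ i < 243, vec i ∈ T → C.testBit i = true) → (bl.map fun b => dT b.v).sum ≤ D →
    search bl S C D = false := by
  induction bl with
  | nil => intros; rfl
  | cons b bs ih =>
    intro S C D hSlt hS hC hD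
    have hb := hg b (List.mem_cons_self)
    obtain ⟨o, ho, hfit⟩ := hf b (List.mem_cons_self)
    have hbd := bound_le hC (b :: bs) hg hf
    have hog := hb.2.2.2.2.2.2 o ho
    have hland := land_eq_of_fits hb hog hfit hC
    rw [List.map_cons, List.sum_cons, ← hfit.1] at hbd hD
    have e : search (b :: bs) S C D =
      Bool.rec true (Bool.rec false (Bool.rec false
        (force (blockMask C b.v) fun m => force (b.f S) fun A => force (b.g S) fun B =>
          tryOpts b (search bs) S C D m A B b.os)
         (Nat.beq (blockMask S b.nv) 0)) (Nat.beq (blockMask S b.v) 0))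
      (Nat.ble (bound (b :: bs) C) D) := rfl
    rw [e]
    simp only [force_eq]
    have e1 : Nat.ble (bound (b :: bs) C) D = true := Nat.ble_eq_true_of_le (by omega)
    rw [e1]
    change Bool.rec false (Bool.rec false _ _) _ = false
    cases hz1 : Nat.beq (blockMask S b.v) 0 with
    | false => rfl
    | true =>
      cases hz2 : Nat.beq (blockMask S b.nv) 0 with
      | false => rfl
      | true =>
        change tryOpts b (search bs) S C D (blockMask C b.v) (b.f S) (b.g S) b.os = false
        by_contra htry
        rw [Bool.not_eq_false] at htry
        have hnext := tryOpts_mem _ _ _ _ _ _ _ _ _ htry o ho hland (by omega)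
        have hz1' := Nat.eq_of_beq_eq_true hz1
        have hz2' := Nat.eq_of_beq_eq_true hz2
        have hbv := hb.1
        have hbnv := hb.2.1
        have hno : ∀ x, o.o.testBit x = true → x < 9 := fun x => lt_nine hog.2.1
        rw [ih (fun c hc => hg c (List.mem_cons_of_mem _ hc))
          (fun c hc => hf c (List.mem_cons_of_mem _ hc)) _ _ _ ?_ ?_ ?_ ?_] at hnext
        · exact Bool.noConfusion hnext
        · -- size
          apply Nat.lt_pow_two_of_testBit
          intro i hi
          by_contra hbit
          rw [Bool.not_eq_false] at hbit
          change (S ||| ((o.o <<< (9 * b.v)) ||| (o.no <<< (9 * b.nv)))).testBit i = true at hbit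
          rw [Nat.testBit_or, Nat.testBit_or, Nat.testBit_shiftLeft, Nat.testBit_shiftLeft] at hbit
          simp only [Bool.or_eq_true, Bool.and_eq_true, decide_eq_true_eq] at hbit
          rcases hbit with h | ⟨h1, h2⟩ | ⟨h1, h2⟩
          · rw [Nat.testBit_lt_two_pow (lt_of_lt_of_le hSlt
              (Nat.pow_le_pow_right (by norm_num) hi))] at h
            exact Bool.noConfusion h
          · have := hno _ h2
            omega
          · obtain ⟨_, _, _, _, h9⟩ := hog.2.2.2.1 _ h2
            omega
        · -- new S
          intro i hbit
          change (S ||| ((o.o <<< (9 * b.v)) ||| (o.no <<< (9 * b.nv)))).testBit i = true at hbit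
          rw [Nat.testBit_or, Nat.testBit_or, Nat.testBit_shiftLeft, Nat.testBit_shiftLeft] at hbit
          simp only [Bool.or_eq_true, Bool.and_eq_true, decide_eq_true_eq] at hbit
          rcases hbit with h | ⟨h1, h2⟩ | ⟨h1, h2⟩
          · exact hS i h
          · have h9 := hno _ h2
            have := (hfit.2 _ h9).2 h2
            rwa [show 9 * b.v + (i - 9 * b.v) = i by omega] at this
          · obtain ⟨y, hy, hy9, hxy, h9⟩ := hog.2.2.2.1 _ h2
            have hin := hT.2.1 _ ((hfit.2 _ hy9).2 hy)
            have : vec i = - vec (9 * b.v + y) := by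
              rw [show i = 9 * b.nv + (i - 9 * b.nv) by omega, vec_block _ hbnv _ h9,
                vec_block _ hbv _ hy9, hb.2.2.2.2.2.1, hxy, neg_add]
            rwa [this]
        · -- new C
          intro i hi hiT
          change (C ^^^ (C &&& (kill (b.f S) (b.g S) o.ps))).testBit i = true
          rw [Nat.testBit_xor, Nat.testBit_and, hC i hi hiT]
          cases hk : (kill (b.f S) (b.g S) o.ps).testBit i with
          | false => rfl
          | true =>
            exfalso
            obtain ⟨p, hp, hor⟩ := kill_mem _ _ _ _ hk
            obtain ⟨hpx, hpnx, hpf, hpg, hpn⟩ := hog.1 p hp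
            have hpT : vec (9 * b.v + p.x) ∈ T := (hfit.2 _ hpx).2 (hog.2.2.1 p hp)
            -- a bit of `S` is never plus or minus the new point
            have hne : ∀ j, S.testBit j = true → vec (9 * b.v + p.x) ≠ vec j ∧
                vec (9 * b.v + p.x) ≠ - vec j := by
              intro j hj
              have hj243 : j < 243 := by
                by_contra hlt
                rw [Nat.testBit_lt_two_pow (lt_of_lt_of_le hSlt
                  (Nat.pow_le_pow_right (by norm_num) (not_lt.1 hlt)))] at hj
                exact Bool.noConfusion hj
              constructor
              · intro heq
                have := vec_inj _ (by omega) _ hj243 heq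
                have hb2 := blockMask_testBit S b.v p.x
                rw [hz1', this, hj] at hb2
                simp [hpx] at hb2
              · intro heq
                have heq' : vec (9 * b.nv + p.nx) = vec j := by
                  rw [vec_block _ hbnv _ hpnx, hb.2.2.2.2.2.1, hpn, ← neg_add,
                    ← vec_block _ hbv _ hpx, heq, neg_neg]
                have := vec_inj _ (by omega) _ hj243 heq'
                have hb2 := blockMask_testBit S b.nv p.nx
                rw [hz2', this, hj] at hb2
                simp [hpnx] at hb2
            rcases hor with h | h
            · obtain ⟨k, hk1, hk2⟩ := hpf _ _ h
              obtain ⟨j, hj1, hj2⟩ := hb.2.2.2.1 _ _ hk1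
              obtain ⟨n1, n2⟩ := hne j hj1
              apply hT.2.2 _ hpT _ (hS j hj1) n1 n2
              have : vec (9 * b.v + p.x) + vec j = vec i := by
                rw [vec_block _ hbv _ hpx, hk2, hj2]; abel
              rwa [this]
            · obtain ⟨k, hk1, hk2⟩ := hpg _ _ h
              obtain ⟨j, hj1, hj2⟩ := hb.2.2.2.2.1 _ _ hk1
              obtain ⟨n1, n2⟩ := hne j hj1
              apply hT.2.2 _ (hT.2.1 _ hpT) _ (hS j hj1)
                (fun e => n2 (by rw [← e, neg_neg])) (fun e => n1 (neg_injective e))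
              have : -vec (9 * b.v + p.x) + vec j = vec i := by
                rw [vec_block _ hbv _ hpx, hk2, hj2]; abel
              rwa [this]
        · -- new D
          omega
theorem search_blocks : search blocks S0 C0 5 = true := by decide +kernel


/-- The number of points of `T` in block `v`. -/
def cnt (T : Finset V) (v : Nat) : Nat :=
  ((Finset.range 9).filter fun x => vec (9 * v + x) ∈ T).card

/-- Two positions in a block differ in both coordinates. -/
def compat (x y : Nat) : Bool := !(Nat.beq (x % 3) (y % 3)) && !(Nat.beq (x / 3) (y / 3))

theorem exists_mask (P : Nat → Prop) : ∃ M < 512, ∀ x < 9, (P x ↔ M.testBit x = true) := by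
  classical
  refine ⟨Nat.ofBits (fun i : Fin 9 => decide (P i.val)), Nat.ofBits_lt_two_pow _, ?_⟩
  intro x hx
  rw [Nat.testBit_ofBits_lt _ _ hx]
  simp

/-- No two bits of the mask in one line, and at most two bits. -/
def maskOk (M : Nat) : Bool :=
  (List.range 9).all fun x => (List.range 9).all fun y => !(M.testBit x) || !(M.testBit y) ||
    x == y || (compat x y && (List.range 9).all fun z => !(M.testBit z) || z == x || z == y)

theorem maskOk_of (M : Nat) (h : ∀ x < 9, M.testBit x = true → ∀ y < 9, M.testBit y = true → x ≠ y →
      compat x y = true ∧ ∀ z < 9, M.testBit z = true → x ≠ z → y ≠ z → False) :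
    maskOk M = true := by
  simp only [maskOk, List.all_eq_true, List.mem_range, Bool.or_eq_true, Bool.and_eq_true,
    Bool.not_eq_true', beq_iff_eq]
  intro x hx y hy
  by_cases hbx : M.testBit x = true
  · by_cases hby : M.testBit y = true
    · by_cases hxy : x = y
      · exact Or.inl (Or.inr hxy)
      · obtain ⟨h1, h2⟩ := h x hx hbx y hy hby hxy
        refine Or.inr ⟨h1, fun z hz => ?_⟩
        by_cases hbz : M.testBit z = true
        · by_cases hzx : z = x
          · exact Or.inl (Or.inr hzx)
          · by_cases hzy : z = y
            · exact Or.inr hzy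
            · exact (h2 z hz hbz (Ne.symm hzx) (Ne.symm hzy)).elim
        · exact Or.inl (Or.inl (Bool.eq_false_iff.2 hbz))
    · exact Or.inl (Or.inl (Or.inr (Bool.eq_false_iff.2 hby)))
  · exact Or.inl (Or.inl (Or.inl (Bool.eq_false_iff.2 hbx)))

theorem maskOk_opts : ∀ M < 512, maskOk M = true →
    ∃ o ∈ opts, o.o = M ∧ o.d + ((Finset.range 9).filter fun x => M.testBit x = true).card = 2 := by
  decide +kernel

theorem opts_full : ∀ o ∈ opts, o.d = 0 → ∃ x < 9, o.o.testBit x = true ∧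
    ∃ y < 9, o.o.testBit y = true ∧ (vec y = vec x + vec 4 ∨ vec y = vec x + vec 7) := by
  decide +kernel

theorem near_points : ∀ x < 9, ∀ y < 9, x ≠ y → compat x y = false →
    ∃ e ∈ [1, 2, 3, 6], vec x = vec y + vec e := by
  decide +kernel

set_option synthInstance.maxHeartbeats 400000 in
set_option synthInstance.maxSize 2048 in
theorem three_points : ∀ x < 9, ∀ y < 9, ∀ z < 9, compat x y = true →
    compat x z = true → compat y z = true →
    vec x + vec y + vec z = 0 := by
  decide +kernel

theorem three_mul_vec (u : V) : u + u + u = 0 := by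
  have : ∀ a : ZMod 3, a + a + a = 0 := by decide
  ext k
  exact this _

theorem block_ne_neg : ∀ v < 27, v ≠ 0 → ∀ x < 9, ∀ y < 9, vec (9 * v + x) ≠ - vec (9 * v + y) := by
  decide +kernel

theorem small_neg : ∀ e ∈ [1, 2, 3, 6], ∃ e' ∈ [1, 2, 3, 6], vec e' = - vec e := by
  decide +kernel

theorem small_mem {T : Finset V} (hT : IsCap T) (h1 : vec 1 ∈ T) (h3 : vec 3 ∈ T) :
    ∀ e ∈ [1, 2, 3, 6], vec e ∈ T := by
  intro e he
  have h2 : vec 2 = - vec 1 := by decide +kernel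
  have h6 : vec 6 = - vec 3 := by decide +kernel
  simp only [List.mem_cons, List.not_mem_nil, or_false] at he
  rcases he with rfl | rfl | rfl | rfl
  · exact h1
  · rw [h2]; exact hT.2.1 _ h1
  · exact h3
  · rw [h6]; exact hT.2.1 _ h3

theorem block_opt {T : Finset V} (hT : IsCap T) (h1 : vec 1 ∈ T) (h3 : vec 3 ∈ T)
    (v : Nat) (hv : v < 27) (hv0 : v ≠ 0) :
    ∃ o ∈ opts, (∀ x < 9, (vec (9 * v + x) ∈ T ↔ o.o.testBit x = true)) ∧ o.d + cnt T v = 2 := by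
  obtain ⟨M, hM, hMT⟩ := exists_mask (fun x => vec (9 * v + x) ∈ T)
  have hcompat : ∀ x < 9, ∀ y < 9, M.testBit x = true → M.testBit y = true → x ≠ y →
      compat x y = true := by
    intro x hx y hy hbx hby hxy
    by_contra hcon
    rw [Bool.not_eq_true] at hcon
    obtain ⟨e, he, hxe⟩ := near_points x hx y hy hxy hcon
    obtain ⟨e', he', hee⟩ := small_neg e he
    have helt : ∀ e ∈ [1, 2, 3, 6], e < 9 := by decide
    have hin : vec (9 * v + x) ∈ T := (hMT x hx).2 hbx
    have hiny : vec (9 * v + y) ∈ T := (hMT y hy).2 hby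
    have h9 := helt e he
    have h9' := helt e' he'
    refine hT.2.2 _ hiny _ (small_mem hT h1 h3 e he) ?_ ?_ ?_
    · intro h
      have := vec_inj _ (by omega) _ (by omega) h
      omega
    · intro h
      rw [← hee] at h
      have := vec_inj _ (by omega) _ (by omega) h
      omega
    · have : vec (9 * v + y) + vec e = vec (9 * v + x) := by
        rw [vec_block _ hv _ hx, vec_block _ hv _ hy, hxe, add_assoc]
      rwa [this]
  obtain ⟨o, ho, hoM, hod⟩ := maskOk_opts M hM (maskOk_of M (by
    intro x hx hbx y hy hby hxy
    refine ⟨hcompat x hx y hy hbx hby hxy, ?_⟩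
    intro z hz hbz hxz hyz
    have hsum := three_points x hx y hy z hz (hcompat x hx y hy hbx hby hxy)
      (hcompat x hx z hz hbx hbz hxz) (hcompat y hy z hz hby hbz hyz)
    refine hT.2.2 _ ((hMT x hx).2 hbx) _ ((hMT y hy).2 hby) ?_ (block_ne_neg v hv hv0 x hx y hy) ?_
    · intro h
      have := vec_inj _ (by omega) _ (by omega) h
      omega
    · have : vec (9 * v + x) + vec (9 * v + y) = - vec (9 * v + z) := by
        rw [eq_neg_iff_add_eq_zero, vec_block _ hv _ hx, vec_block _ hv _ hy, vec_block _ hv _ hz]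
        have h3v := three_mul_vec (vec (9 * v))
        calc _ = (vec (9 * v) + vec (9 * v) + vec (9 * v)) + (vec x + vec y + vec z) := by abel
          _ = 0 := by rw [h3v, hsum, add_zero]
      rw [this]
      exact hT.2.1 _ ((hMT z hz).2 hbz)))
  refine ⟨o, ho, ?_, ?_⟩
  · intro x hx
    rw [hoM]
    exact hMT x hx
  · rw [← hod, cnt]
    congr 2
    apply Finset.filter_congr
    intro x hx
    exact hMT x (Finset.mem_range.1 hx)

theorem cnt_zero {T : Finset V} (hT : IsCap T) (h1 : vec 1 ∈ T) (h3 : vec 3 ∈ T) :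
    cnt T 0 ≤ 4 := by
  have hs := small_mem hT h1 h3
  have hsub : ((Finset.range 9).filter fun x => vec (9 * 0 + x) ∈ T) ⊆ {1, 2, 3, 6} := by
    intro x hx
    rw [Finset.mem_filter, Finset.mem_range, Nat.mul_zero, Nat.zero_add] at hx
    by_contra hne
    have key : ∀ x < 9, x ∉ ({1, 2, 3, 6} : Finset Nat) → vec x = 0 ∨
        ∃ a ∈ [1, 2, 3, 6], ∃ b ∈ [1, 2, 3, 6], vec a ≠ vec b ∧ vec a ≠ - vec b ∧
          vec x = vec a + vec b := by decide +kernel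
    rcases key x hx.1 hne with h | ⟨a, ha, b, hb, hab, hab', h⟩
    · exact hT.1 (h ▸ hx.2)
    · exact hT.2.2 _ (hs a ha) _ (hs b hb) hab hab' (h ▸ hx.2)
  exact Finset.card_le_card hsub

theorem cnt_neg_le {T : Finset V} (hT : IsCap T) (v w : Nat) (hv : v < 27) (hw : w < 27)
    (h : vec (9 * w) = - vec (9 * v)) : cnt T v ≤ cnt T w := by
  have key : ∀ x < 9, (3 - x % 3) % 3 + 3 * ((3 - x / 3) % 3) < 9 ∧
      vec ((3 - x % 3) % 3 + 3 * ((3 - x / 3) % 3)) = - vec x := by decide +kernel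
  apply Finset.card_le_card_of_injOn (fun x => (3 - x % 3) % 3 + 3 * ((3 - x / 3) % 3))
  · intro x hx
    have hx' := Finset.mem_filter.1 hx
    have hx9 := Finset.mem_range.1 hx'.1
    obtain ⟨k1, k2⟩ := key x hx9
    refine Finset.mem_coe.2 (Finset.mem_filter.2 ⟨Finset.mem_range.2 k1, ?_⟩)
    rw [vec_block _ hw _ k1, h, k2, ← neg_add, ← vec_block _ hv _ hx9]
    exact hT.2.1 _ hx'.2
  · intro x hx y hy hxy
    have hx9 := Finset.mem_range.1 (Finset.mem_filter.1 (Finset.mem_coe.1 hx)).1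
    have hy9 := Finset.mem_range.1 (Finset.mem_filter.1 (Finset.mem_coe.1 hy)).1
    simp only at hxy
    omega

theorem card_le_sum_cnt (T : Finset V) : T.card ≤ ∑ v ∈ Finset.range 27, cnt T v := by
  classical
  have hsub : T ⊆ (Finset.range 27).biUnion fun v =>
      ((Finset.range 9).filter fun x => vec (9 * v + x) ∈ T).image fun x => vec (9 * v + x) := by
    intro t ht
    obtain ⟨i, hi, rfl⟩ := vec_surj t
    rw [Finset.mem_biUnion]
    refine ⟨i / 9, Finset.mem_range.2 (by omega), Finset.mem_image.2 ⟨i % 9, ?_, ?_⟩⟩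
    · rw [Finset.mem_filter, Nat.div_add_mod]
      exact ⟨Finset.mem_range.2 (by omega), ht⟩
    · rw [Nat.div_add_mod]
  refine (Finset.card_le_card hsub).trans (Finset.card_biUnion_le.trans ?_)
  exact Finset.sum_le_sum fun v _ => Finset.card_image_le

/-- The normalised situation is impossible. -/
theorem normalised_false {T : Finset V} (hT : IsCap T) (hc : 45 ≤ T.card)
    (h : ∀ i ∈ [1, 3, 9, 27, 81, 13, 31, 85], vec i ∈ T) : False := by
  have h1 : vec 1 ∈ T := h 1 (by decide)
  have h3 : vec 3 ∈ T := h 3 (by decide)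
  have hle : ∀ v < 27, v ≠ 0 → cnt T v ≤ 2 := by
    intro v hv hv0
    obtain ⟨o, _, _, ho⟩ := block_opt hT h1 h3 v hv hv0
    omega
  have hz := cnt_zero hT h1 h3
  have hsum := hc.trans (card_le_sum_cnt T)
  have hneg : ∀ b ∈ blocks, cnt T b.nv ≤ cnt T b.v := by
    intro b hb
    obtain ⟨g1, g2, _, _, _, g3, _⟩ := blocks_good b hb
    exact cnt_neg_le hT _ _ g2 g1 (by rw [g3, neg_neg])
  have hD : (blocks.map fun b => 2 - cnt T b.v).sum ≤ 5 := by
    have hl : ∀ b ∈ blocks, cnt T b.v ≤ 2 := by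
      intro b hb
      obtain ⟨g1, _, g0, _⟩ := blocks_good b hb
      exact hle _ g1 g0
    simp only [Finset.sum_range_succ, Finset.sum_range_zero] at hsum
    simp only [blocks, List.forall_mem_cons, List.not_mem_nil, false_imp_iff, implies_true,
      and_true] at hneg hl
    simp only [blocks, List.map_cons, List.map_nil, List.sum_cons, List.sum_nil]
    omega
  have hf : ∀ b ∈ blocks, ∃ o ∈ b.os, Fits T (fun v => 2 - cnt T v) b o := by
    intro b hb
    obtain ⟨g1, _, g0, _⟩ := blocks_good b hb
    obtain ⟨o, ho, hbits, hd⟩ := block_opt hT h1 h3 b.v g1 g0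
    have hos : b.os = opts ∨ (b.os = opt04 ∧ (b.v = 1 ∨ b.v = 3 ∨ b.v = 9)) := by
      revert b
      simp only [blocks, List.forall_mem_cons, List.not_mem_nil, false_imp_iff, implies_true,
        and_true]
      simp
    refine ⟨o, ?_, by change o.d = 2 - cnt T b.v; omega, hbits⟩
    rcases hos with hos | ⟨hos, hv⟩
    · rwa [hos]
    · have b0 : o.o.testBit 0 = true := by
        rw [← hbits 0 (by norm_num)]
        rcases hv with hv | hv | hv <;> rw [hv] <;> exact h _ (by decide)
      have b4 : o.o.testBit 4 = true := by
        rw [← hbits 4 (by norm_num)]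
        rcases hv with hv | hv | hv <;> rw [hv] <;> exact h _ (by decide)
      rw [hos]
      have : o = ⟨17, 257, 0, [p0, p4]⟩ := by
        simp only [opts, List.mem_cons, List.not_mem_nil, or_false] at ho
        clear hbits hd
        rcases ho with rfl | ho
        · rfl
        · exfalso
          revert b0 b4
          repeat' rcases ho with rfl | ho
          all_goals decide
      rw [this]
      exact List.mem_cons_self
  have := search_sound hT (fun v => 2 - cnt T v) blocks blocks_good hf S0 C0 5 (by norm_num [S0])
    ?_ ?_ hD
  · rw [search_blocks] at this
    exact Bool.noConfusion this
  · intro i hi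
    have hi' : i ∈ [1, 2, 3, 6] := by
      have : i < 9 := lt_nine (by norm_num [S0]) hi
      revert hi
      revert i
      decide
    exact small_mem hT h1 h3 i hi'
  · intro i hi _
    have : C0 = 2 ^ 243 - 1 := by norm_num [C0]
    rw [this, Nat.testBit_two_pow_sub_one]
    simpa using hi

theorem transport {T : Finset V} (hT : IsCap T) (b : Fin 5 → V)
    (hb : LinearIndependent (ZMod 3) b) :
    ∃ T' : Finset V, IsCap T' ∧ T'.card = T.card ∧ ∀ u : V, u ∈ T' ↔ ∑ i, u i • b i ∈ T := by
  classical
  let φ : V →ₗ[ZMod 3] V := Fintype.linearCombination (ZMod 3) b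
  have hφ : Function.Injective φ := linearIndependent_iff_injective_fintypeLinearCombination.1 hb
  have hbij : Function.Bijective φ := Finite.injective_iff_bijective.1 hφ
  refine ⟨Finset.univ.filter fun u => φ u ∈ T, ⟨?_, ?_, ?_⟩, ?_, ?_⟩
  · simpa using hT.1
  · intro x hx
    rw [Finset.mem_filter] at hx ⊢
    refine ⟨Finset.mem_univ _, ?_⟩
    rw [map_neg]
    exact hT.2.1 _ hx.2
  · intro x hx y hy h1 h2 h3
    rw [Finset.mem_filter] at hx hy h3
    rw [map_add] at h3
    refine hT.2.2 _ hx.2 _ hy.2 (fun h => h1 (hφ h)) (fun h => h2 (hφ ?_)) h3.2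
    rw [h, map_neg]
  · refine Finset.card_bij (fun u _ => φ u) ?_ ?_ ?_
    · intro u hu
      exact (Finset.mem_filter.1 hu).2
    · intro u _ w _ h
      exact hφ h
    · intro w hw
      obtain ⟨u, rfl⟩ := hbij.2 w
      exact ⟨u, Finset.mem_filter.2 ⟨Finset.mem_univ _, hw⟩, rfl⟩
  · intro u
    rw [Finset.mem_filter]
    simp only [Finset.mem_univ, true_and]
    rfl

theorem extend_step {n : Nat} (hn : n < 5) (v : Fin n → V) (hv : LinearIndependent (ZMod 3) v)
    (t : Set V) (ht : Submodule.span (ZMod 3) t = ⊤) :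
    ∃ x ∈ t, LinearIndependent (ZMod 3) (Fin.cons x v : Fin (n + 1) → V) := by
  by_contra hcon
  push Not at hcon
  have hsub : t ⊆ Submodule.span (ZMod 3) (Set.range v) := by
    intro x hx
    by_contra hx'
    exact hcon x hx (linearIndependent_finCons.2 ⟨hv, hx'⟩)
  have htop : Submodule.span (ZMod 3) (Set.range v) = ⊤ := by
    rw [eq_top_iff, ← ht]
    exact Submodule.span_le.2 hsub
  have h1 := finrank_range_le_card (R := ZMod 3) v
  rw [Set.finrank, htop, finrank_top, Fintype.card_fin] at h1
  have h2 : Module.finrank (ZMod 3) V = 5 := by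
    rw [Module.finrank_pi, Fintype.card_fin]
  omega

theorem extend_pair (p q : V) (h : LinearIndependent (ZMod 3) ![p, q])
    (t : Set V) (ht : Submodule.span (ZMod 3) t = ⊤) :
    ∃ x ∈ t, ∃ y ∈ t, ∃ z ∈ t, LinearIndependent (ZMod 3) ![p, q, x, y, z] := by
  obtain ⟨x, hx, h3⟩ := extend_step (by norm_num) _ h t ht
  obtain ⟨y, hy, h4⟩ := extend_step (by norm_num) _ h3 t ht
  obtain ⟨z, hz, h5⟩ := extend_step (by norm_num) _ h4 t ht
  refine ⟨x, hx, y, hy, z, hz, ?_⟩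
  have h6 := h5.comp (![3, 4, 2, 1, 0] : Fin 5 → Fin 5) (by decide)
  have e : (![p, q, x, y, z] : Fin 5 → V) =
      (Fin.cons z (Fin.cons y (Fin.cons x ![p, q] : Fin 3 → V) : Fin 4 → V) : Fin 5 → V) ∘
        (![3, 4, 2, 1, 0] : Fin 5 → Fin 5) := by
    funext i
    fin_cases i <;> rfl
  rw [e]
  exact h6

theorem span_false {T : Finset V} (hT : IsCap T) (hc : 45 ≤ T.card) (p q : V)
    (hp : p ∈ T) (hq : q ∈ T) (hpq : LinearIndependent (ZMod 3) ![p, q])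
    (ht : Submodule.span (ZMod 3) ({p, q} ∪ {a : V | a ∈ T ∧ a + (p + q) ∈ T}) = ⊤) : False := by
  obtain ⟨x, hx, y, hy, z, hz, hli⟩ := extend_pair p q hpq _ ht
  have hinj := hli.injective
  have hmem : ∀ i : Fin 5, 2 ≤ i → (![p, q, x, y, z] i) ∈ ({p, q} ∪ {a : V | a ∈ T ∧ a + (p + q) ∈ T} : Set V) →
      ![p, q, x, y, z] i ∈ T ∧ ![p, q, x, y, z] i + (p + q) ∈ T := by
    intro i hi h
    rcases h with h | h
    · exfalso
      rcases h with h | h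
      · have := @hinj i 0 h
        subst this
        exact absurd hi (by decide)
      · have := @hinj i 1 h
        subst this
        exact absurd hi (by decide)
    · exact h
  have hx' : x ∈ T ∧ x + (p + q) ∈ T := hmem 2 (by decide) hx
  have hy' : y ∈ T ∧ y + (p + q) ∈ T := hmem 3 (by decide) hy
  have hz' : z ∈ T ∧ z + (p + q) ∈ T := hmem 4 (by decide) hz
  obtain ⟨T', hT', hc', hm⟩ := transport hT _ hli
  refine normalised_false hT' (hc'.symm ▸ hc) ?_
  have e1 : vec 1 = ![1, 0, 0, 0, 0] := by decide +kernel
  have e3 : vec 3 = ![0, 1, 0, 0, 0] := by decide +kernel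
  have e9 : vec 9 = ![0, 0, 1, 0, 0] := by decide +kernel
  have e27 : vec 27 = ![0, 0, 0, 1, 0] := by decide +kernel
  have e81 : vec 81 = ![0, 0, 0, 0, 1] := by decide +kernel
  have e13 : vec 13 = ![1, 1, 1, 0, 0] := by decide +kernel
  have e31 : vec 31 = ![1, 1, 0, 1, 0] := by decide +kernel
  have e85 : vec 85 = ![1, 1, 0, 0, 1] := by decide +kernel
  intro i hi
  rw [hm]
  simp only [List.mem_cons, List.not_mem_nil, or_false] at hi
  rcases hi with rfl | rfl | rfl | rfl | rfl | rfl | rfl | rfl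
  · simpa [e1, Fin.sum_univ_five] using hp
  · simpa [e3, Fin.sum_univ_five] using hq
  · simpa [e9, Fin.sum_univ_five] using hx'.1
  · simpa [e27, Fin.sum_univ_five] using hy'.1
  · simpa [e81, Fin.sum_univ_five] using hz'.1
  · simpa [e13, Fin.sum_univ_five, add_comm] using hx'.2
  · simpa [e31, Fin.sum_univ_five, add_comm] using hy'.2
  · simpa [e85, Fin.sum_univ_five, add_comm] using hz'.2

theorem pair_li {p q : V} (hp : p ≠ 0) (hq : q ≠ 0) (h1 : q ≠ p) (h2 : q ≠ -p) :
    LinearIndependent (ZMod 3) ![p, q] := by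
  rw [LinearIndependent.pair_iff]
  intro s t h
  have hz : ∀ s : ZMod 3, s = 0 ∨ s = 1 ∨ s = -1 := by decide
  rcases hz s with rfl | rfl | rfl <;> rcases hz t with rfl | rfl | rfl <;>
    simp only [zero_smul, one_smul, neg_smul, zero_add, add_zero, neg_eq_zero] at h
  · exact ⟨rfl, rfl⟩
  · exact (hq h).elim
  · exact (hq h).elim
  · exact (hp h).elim
  · exact (h2 (eq_neg_of_add_eq_zero_right h)).elim
  · exact (h1 (add_neg_eq_zero.1 h).symm).elim
  · exact (hp h).elim
  · exact (h1 (by rw [neg_add_eq_zero] at h; exact h.symm)).elim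
  · exact (h2 (by rw [← neg_add, neg_eq_zero] at h; exact eq_neg_of_add_eq_zero_right h)).elim

/-- The linear form on blocks with coefficients `a`, `b`, `c`. -/
def lin (a b c : ZMod 3) (v : Nat) : ZMod 3 :=
  ((v : Nat) : ZMod 3) * a + ((v / 3 : Nat) : ZMod 3) * b + ((v / 9 : Nat) : ZMod 3) * c

theorem lin_card : ∀ a b c : ZMod 3, (a ≠ 0 ∨ b ≠ 0 ∨ c ≠ 0) →
    ∀ a' b' c' : ZMod 3, (a' ≠ 0 ∨ b' ≠ 0 ∨ c' ≠ 0) →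
    ((Finset.range 27).filter fun v => v ≠ 0 ∧ (lin a b c v = 0 ∨ lin a' b' c' v = 0)).card ≤ 14 := by
  decide +kernel

theorem vec_nine : ∀ v < 27, vec (9 * v) = ((v : Nat) : ZMod 3) • vec 9 +
    ((v / 3 : Nat) : ZMod 3) • vec 27 + ((v / 9 : Nat) : ZMod 3) • vec 81 := by
  decide +kernel

theorem vec_small : ∀ x < 9, vec x = ((x : Nat) : ZMod 3) • vec 1 +
    ((x / 3 : Nat) : ZMod 3) • vec 3 := by
  decide +kernel

theorem form_vec (f : V →ₗ[ZMod 3] ZMod 3) (h1 : f (vec 1) = 0) (h3 : f (vec 3) = 0)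
    (v : Nat) (hv : v < 27) (x : Nat) (hx : x < 9) :
    f (vec (9 * v + x)) = lin (f (vec 9)) (f (vec 27)) (f (vec 81)) v := by
  rw [vec_block v hv x hx, vec_nine v hv, vec_small x hx]
  simp only [map_add, map_smul, h1, h3, smul_eq_mul, mul_zero, add_zero, lin]

theorem form_ne (f : V →ₗ[ZMod 3] ZMod 3) (hf : f ≠ 0) (h1 : f (vec 1) = 0) (h3 : f (vec 3) = 0) :
    f (vec 9) ≠ 0 ∨ f (vec 27) ≠ 0 ∨ f (vec 81) ≠ 0 := by
  by_contra hcon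
  push Not at hcon
  apply hf
  refine LinearMap.ext fun u => ?_
  obtain ⟨i, hi, rfl⟩ := vec_surj u
  rw [← Nat.div_add_mod i 9, form_vec f h1 h3 _ (by omega) _ (by omega), hcon.1, hcon.2.1,
    hcon.2.2]
  simp [lin]

theorem exists_form (t : Set V) (ht : Submodule.span (ZMod 3) t ≠ ⊤) :
    ∃ f : V →ₗ[ZMod 3] ZMod 3, f ≠ 0 ∧ ∀ a ∈ t, f a = 0 := by
  obtain ⟨f, hf, hle⟩ := Submodule.exists_le_ker_of_lt_top _ (lt_top_iff_ne_top.2 ht)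
  exact ⟨f, hf, fun a ha => hle (Submodule.subset_span ha)⟩

theorem stage_two {T : Finset V} (hT : IsCap T) (hc : 45 ≤ T.card)
    (h1 : vec 1 ∈ T) (h3 : vec 3 ∈ T) : False := by
  have h6 : vec 6 ∈ T := small_mem hT h1 h3 6 (by decide)
  have e4 : vec 4 = vec 1 + vec 3 := by decide +kernel
  have e7 : vec 7 = vec 1 + vec 6 := by decide +kernel
  have e63 : vec 6 = - vec 3 := by decide +kernel
  have hA : Submodule.span (ZMod 3)
      ({vec 1, vec 3} ∪ {a : V | a ∈ T ∧ a + (vec 1 + vec 3) ∈ T}) ≠ ⊤ := fun h =>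
    span_false hT hc _ _ h1 h3 (pair_li (by decide +kernel) (by decide +kernel)
      (by decide +kernel) (by decide +kernel)) h
  have hB : Submodule.span (ZMod 3)
      ({vec 1, vec 6} ∪ {a : V | a ∈ T ∧ a + (vec 1 + vec 6) ∈ T}) ≠ ⊤ := fun h =>
    span_false hT hc _ _ h1 h6 (pair_li (by decide +kernel) (by decide +kernel)
      (by decide +kernel) (by decide +kernel)) h
  obtain ⟨f, hf, hf0⟩ := exists_form _ hA
  obtain ⟨g, hg, hg0⟩ := exists_form _ hB
  have f1 : f (vec 1) = 0 := hf0 _ (Or.inl (Or.inl rfl))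
  have f3 : f (vec 3) = 0 := hf0 _ (Or.inl (Or.inr rfl))
  have g1 : g (vec 1) = 0 := hg0 _ (Or.inl (Or.inl rfl))
  have g3 : g (vec 3) = 0 := by
    have := hg0 (vec 6) (Or.inl (Or.inr rfl))
    rwa [e63, map_neg, neg_eq_zero] at this
  have hcard := lin_card _ _ _ (form_ne f hf f1 f3) _ _ _ (form_ne g hg g1 g3)
  set F := (Finset.range 27).filter fun v => v ≠ 0 ∧
    (lin (f (vec 9)) (f (vec 27)) (f (vec 81)) v = 0 ∨
      lin (g (vec 9)) (g (vec 27)) (g (vec 81)) v = 0) with hF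
  have hle : ∀ v ∈ (Finset.range 27).erase 0, cnt T v ≤ 1 + if v ∈ F then 1 else 0 := by
    intro v hv
    rw [Finset.mem_erase, Finset.mem_range] at hv
    obtain ⟨o, ho, hbits, hd⟩ := block_opt hT h1 h3 v hv.2 hv.1
    by_cases hd0 : o.d = 0
    · have hvF : v ∈ F := by
        rw [hF, Finset.mem_filter, Finset.mem_range]
        refine ⟨hv.2, hv.1, ?_⟩
        obtain ⟨x, hx, hbx, y, hy, hby, hxy⟩ := opts_full o ho hd0
        have hxT := (hbits x hx).2 hbx
        have hyT := (hbits y hy).2 hby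
        rcases hxy with hxy | hxy
        · left
          rw [← form_vec f f1 f3 v hv.2 x hx]
          refine hf0 _ (Or.inr ⟨hxT, ?_⟩)
          rw [← e4, vec_block v hv.2 x hx, add_assoc, ← hxy, ← vec_block v hv.2 y hy]
          exact hyT
        · right
          rw [← form_vec g g1 g3 v hv.2 x hx]
          refine hg0 _ (Or.inr ⟨hxT, ?_⟩)
          rw [← e7, vec_block v hv.2 x hx, add_assoc, ← hxy, ← vec_block v hv.2 y hy]
          exact hyT
      rw [if_pos hvF]
      omega
    · omega
  have hs := card_le_sum_cnt T
  rw [← Finset.add_sum_erase _ _ (Finset.mem_range.2 (by norm_num : 0 < 27))] at hs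
  have hz := cnt_zero hT h1 h3
  have hs2 := Finset.sum_le_sum hle
  rw [Finset.sum_add_distrib, Finset.sum_const, Finset.card_erase_of_mem (by simp),
    Finset.card_range, ← Finset.card_filter] at hs2
  have hs3 : (((Finset.range 27).erase 0).filter fun v => v ∈ F).card ≤ F.card :=
    Finset.card_le_card fun v hv => (Finset.mem_filter.1 hv).2
  simp only [smul_eq_mul] at hs2
  omega

theorem cap_card_lt {T : Finset V} (hT : IsCap T) : T.card < 45 := by
  classical
  by_contra hcon
  push Not at hcon
  obtain ⟨p, hp⟩ : T.Nonempty := Finset.card_pos.1 (by omega)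
  obtain ⟨q, hq, hq'⟩ : ∃ q ∈ T, q ∉ ({p, -p} : Finset V) := by
    by_contra h
    push Not at h
    have h1 : T.card ≤ ({p, -p} : Finset V).card := Finset.card_le_card h
    have h2 : ({p, -p} : Finset V).card ≤ 2 := Finset.card_le_two
    omega
  simp only [Finset.mem_insert, Finset.mem_singleton, not_or] at hq'
  have hp0 : p ≠ 0 := fun h => hT.1 (h ▸ hp)
  have hq0 : q ≠ 0 := fun h => hT.1 (h ▸ hq)
  obtain ⟨x, _, y, _, z, _, hli⟩ := extend_pair p q (pair_li hp0 hq0 hq'.1 hq'.2) Set.univ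
    Submodule.span_univ
  obtain ⟨T', hT', hc', hm⟩ := transport hT _ hli
  have e1 : vec 1 = ![1, 0, 0, 0, 0] := by decide +kernel
  have e3 : vec 3 = ![0, 1, 0, 0, 0] := by decide +kernel
  refine stage_two hT' (hc'.symm ▸ hcon) ?_ ?_
  · rw [hm]
    simpa [e1, Fin.sum_univ_five] using hp
  · rw [hm]
    simpa [e3, Fin.sum_univ_five] using hq

end CapSearch

namespace CapSearch

theorem wzss_of_triple {S : Multiset V} {a b c : V} (h : ({a, b, c} : Multiset V) ≤ S)
    (hs : a + b + c = 0 ∨ a + b = c ∨ a + c = b ∨ b + c = a) : HasWZSS S 3 := by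
  rcases hs with hs | hs | hs | hs
  · refine ⟨{a, b, c}, 0, by simpa using h, by simp, ?_⟩
    simpa [add_assoc] using hs
  · refine ⟨{a, b}, {c}, by simpa using h, by simp, by simpa using hs⟩
  · refine ⟨{a, c}, {b}, le_trans (le_of_eq ?_) h, by simp, by simpa using hs⟩
    ext u
    simp only [Multiset.insert_eq_cons, Multiset.count_add, Multiset.count_cons,
      Multiset.count_singleton]
    omega
  · refine ⟨{b, c}, {a}, le_trans (le_of_eq ?_) h, by simp, by simpa using hs⟩
    ext u
    simp only [Multiset.insert_eq_cons, Multiset.count_add, Multiset.count_cons,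
      Multiset.count_singleton]

theorem add_self_eq_neg (u : V) : u + u = -u := eq_neg_of_add_eq_zero_left (three_mul_vec u)

theorem ne_neg_self {u : V} (hu : u ≠ 0) : u ≠ -u := by
  intro h
  apply hu
  have h1 := three_mul_vec u
  nth_rewrite 1 [h] at h1
  simpa using h1

theorem triple_le_of_nodup {S : Multiset V} {a b c : V} (ha : a ∈ S) (hb : b ∈ S) (hc : c ∈ S)
    (hab : a ≠ b) (hac : a ≠ c) (hbc : b ≠ c) : ({a, b, c} : Multiset V) ≤ S := by
  rw [Multiset.le_iff_subset (by simp [hab, hac, hbc])]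
  intro u hu
  simp only [Multiset.insert_eq_cons, Multiset.mem_cons, Multiset.mem_singleton] at hu
  rcases hu with rfl | rfl | rfl
  · exact ha
  · exact hb
  · exact hc

theorem rep_le {S : Multiset V} {a : V} (h : 3 ≤ S.count a) : ({a, a, a} : Multiset V) ≤ S :=
  Multiset.le_count_iff_replicate_le.1 h

theorem rep_two_le {S : Multiset V} {a b : V} (hab : a ≠ b) (h : 2 ≤ S.count a) (hb : b ∈ S) :
    ({a, a, b} : Multiset V) ≤ S := by
  rw [Multiset.le_iff_count]
  intro u
  have hb' := Multiset.one_le_count_iff_mem.2 hb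
  simp only [Multiset.insert_eq_cons, Multiset.count_cons, Multiset.count_singleton]
  by_cases h1 : u = a
  · subst h1
    simpa [hab] using h
  · by_cases h2 : u = b
    · subst h2
      simpa [h1] using hb'
    · simp [h1, h2]

/-- The support of `S`, made symmetric, without zero. -/
def supp (S : Multiset V) : Finset V :=
  Finset.univ.filter fun x => x ≠ 0 ∧ (x ∈ S ∨ -x ∈ S)

theorem mem_supp {S : Multiset V} {x : V} : x ∈ supp S ↔ x ≠ 0 ∧ (x ∈ S ∨ -x ∈ S) := by
  simp [supp]

theorem supp_cap {S : Multiset V} (hS : ¬ HasWZSS S 3) : IsCap (supp S) := by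
  refine ⟨fun h => (mem_supp.1 h).1 rfl, ?_, ?_⟩
  · intro x hx
    rw [mem_supp] at hx ⊢
    refine ⟨neg_ne_zero.2 hx.1, ?_⟩
    rw [neg_neg]
    exact hx.2.symm
  · intro x hx y hy hxy hxy' hz
    rw [mem_supp] at hx hy hz
    have key : ∀ a ∈ S, ∀ b ∈ S, ∀ c ∈ S, (a = x ∨ a = -x) → (b = y ∨ b = -y) →
        (c = x + y ∨ c = -(x + y)) → False := by
      intro a ha b hb c hc hax hby hcz
      have n1 : x ≠ x + y := fun h => hy.1 (by simpa using h)
      have n2 : x ≠ -(x + y) := by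
        intro h
        apply hxy
        have h1 : x + x = -y := by
          nth_rewrite 2 [h]
          abel
        rw [add_self_eq_neg, neg_inj] at h1
        exact h1
      have n3 : y ≠ x + y := fun h => hx.1 (by simpa using h)
      have n4 : y ≠ -(x + y) := by
        intro h
        apply hxy
        have h1 : y + y = -x := by
          nth_rewrite 2 [h]
          abel
        rw [add_self_eq_neg, neg_inj] at h1
        exact h1.symm
      have hab : a ≠ b := by
        rcases hax with rfl | rfl <;> rcases hby with rfl | rfl
        · exact hxy
        · exact hxy'
        · exact fun h => hxy' (neg_eq_iff_eq_neg.1 h)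
        · exact fun h => hxy (neg_inj.1 h)
      have hac : a ≠ c := by
        rcases hax with rfl | rfl <;> rcases hcz with rfl | rfl
        · exact n1
        · exact n2
        · exact fun h => n2 (neg_eq_iff_eq_neg.1 h)
        · exact fun h => n1 (neg_inj.1 h)
      have hbc : b ≠ c := by
        rcases hby with rfl | rfl <;> rcases hcz with rfl | rfl
        · exact n3
        · exact n4
        · exact fun h => n4 (neg_eq_iff_eq_neg.1 h)
        · exact fun h => n3 (neg_inj.1 h)
      refine hS (wzss_of_triple (triple_le_of_nodup ha hb hc hab hac hbc) ?_)
      rcases hax with rfl | rfl <;> rcases hby with rfl | rfl <;> rcases hcz with rfl | rfl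
      · exact Or.inr (Or.inl rfl)
      · exact Or.inl (by abel)
      · exact Or.inr (Or.inr (Or.inr (by abel)))
      · exact Or.inr (Or.inr (Or.inl (by abel)))
      · exact Or.inr (Or.inr (Or.inl (by abel)))
      · exact Or.inr (Or.inr (Or.inr (by abel)))
      · exact Or.inl (by abel)
      · exact Or.inr (Or.inl (by abel))
    rcases hx.2 with hx2 | hx2 <;> rcases hy.2 with hy2 | hy2 <;> rcases hz.2 with hz2 | hz2 <;>
      exact key _ hx2 _ hy2 _ hz2 (by simp) (by simp) (by simp)

theorem count_pair {S : Multiset V} (hS : ¬ HasWZSS S 3) {x : V} (hx : x ≠ 0) :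
    S.count x + S.count (-x) ≤ 2 := by
  by_contra hcon
  have c1 : ∀ u : V, S.count u ≤ 2 := by
    intro u
    by_contra h
    exact hS (wzss_of_triple (rep_le (a := u) (by omega)) (Or.inl (three_mul_vec u)))
  have c2 : ∀ u : V, u ≠ 0 → 2 ≤ S.count u → 1 ≤ S.count (-u) → False := by
    intro u hu h1 h2
    exact hS (wzss_of_triple (rep_two_le (ne_neg_self hu) h1 (Multiset.one_le_count_iff_mem.1 h2))
      (Or.inr (Or.inl (add_self_eq_neg u))))
  have h1 := c1 x
  have h2 := c1 (-x)
  by_cases h : 2 ≤ S.count x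
  · exact c2 x hx h (by omega)
  · exact c2 (-x) (neg_ne_zero.2 hx) (by omega) (by rw [neg_neg]; omega)

theorem count_pair_zero {S : Multiset V} (hS : ¬ HasWZSS S 3) (h0 : (0 : V) ∈ S) {x : V}
    (hx : x ≠ 0) : S.count x + S.count (-x) ≤ 1 := by
  by_contra hcon
  have c1 : ∀ u : V, u ≠ 0 → S.count u ≤ 1 := by
    intro u hu
    by_contra h
    exact hS (wzss_of_triple (rep_two_le hu (by omega) h0)
      (Or.inr (Or.inr (Or.inl (add_zero u)))))
  have h1 := c1 x hx
  have h2 := c1 (-x) (neg_ne_zero.2 hx)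
  have m1 : x ∈ S := Multiset.one_le_count_iff_mem.1 (by omega)
  have m2 : -x ∈ S := Multiset.one_le_count_iff_mem.1 (by omega)
  exact hS (wzss_of_triple (triple_le_of_nodup m1 m2 h0 (ne_neg_self hx) hx (neg_ne_zero.2 hx))
    (Or.inl (by simp)))

theorem two_card (S : Multiset V) :
    2 * Multiset.card S = ∑ x : V, (S.count x + S.count (-x)) := by
  have h1 : ∑ x : V, S.count x = Multiset.card S :=
    Multiset.sum_count_eq_card fun a _ => Finset.mem_univ a
  have h2 : ∑ x : V, S.count (-x) = ∑ x : V, S.count x :=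
    Equiv.sum_comp (Equiv.neg V) fun x => S.count x
  rw [Finset.sum_add_distrib, h2, h1, two_mul]

theorem count_supp {S : Multiset V} {x : V} (hx : x ≠ 0) (h : x ∉ supp S) :
    S.count x + S.count (-x) = 0 := by
  rw [mem_supp] at h
  have h1 : x ∉ S := fun hm => h ⟨hx, Or.inl hm⟩
  have h2 : -x ∉ S := fun hm => h ⟨hx, Or.inr hm⟩
  rw [Multiset.count_eq_zero_of_notMem h1, Multiset.count_eq_zero_of_notMem h2]

theorem upper (S : Multiset V) (hc : 45 ≤ Multiset.card S) : HasWZSS S 3 := by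
  by_contra hS
  have hlt := cap_card_lt (supp_cap hS)
  have h2 := two_card S
  by_cases h0 : (0 : V) ∈ S
  · have hle : ∀ x ∈ (Finset.univ : Finset V), S.count x + S.count (-x) ≤
        (if x = 0 then 4 else 0) + (if x ∈ supp S then 1 else 0) := by
      intro x _
      by_cases hx : x = 0
      · subst hx
        rw [if_pos rfl, neg_zero]
        have : S.count (0 : V) ≤ 2 := by
          by_contra h
          exact hS (wzss_of_triple (rep_le (a := 0) (by omega)) (Or.inl (by simp)))
        omega
      · rw [if_neg hx]
        by_cases hxs : x ∈ supp S
        · rw [if_pos hxs]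
          have := count_pair_zero hS h0 hx
          omega
        · rw [count_supp hx hxs]
          omega
    have hs := Finset.sum_le_sum hle
    rw [← h2, Finset.sum_add_distrib, Finset.sum_ite_eq' Finset.univ (0 : V), if_pos (Finset.mem_univ _),
      ← Finset.card_filter, Finset.filter_univ_mem] at hs
    omega
  · have hle : ∀ x ∈ (Finset.univ : Finset V), S.count x + S.count (-x) ≤
        (if x ∈ supp S then 1 else 0) + (if x ∈ supp S then 1 else 0) := by
      intro x _
      by_cases hx : x = 0
      · subst hx
        rw [neg_zero, Multiset.count_eq_zero_of_notMem h0]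
        omega
      · by_cases hxs : x ∈ supp S
        · rw [if_pos hxs]
          exact count_pair hS hx
        · rw [count_supp hx hxs]
          omega
    have hs := Finset.sum_le_sum hle
    rw [← h2, Finset.sum_add_distrib, ← Finset.card_filter, Finset.filter_univ_mem] at hs
    omega

/-- Indices of the twenty points of an elliptic quadric in affine four-space, placed in the
hyperplane where the first coordinate is one. -/
def quadric : List Nat :=
  [28, 55, 82, 121, 124, 130, 133, 139, 142, 145, 154, 163, 193, 196, 199, 208, 229, 232, 238, 241]

theorem quadric_cap : ∀ i ∈ quadric, ∀ j ∈ quadric, ∀ k ∈ quadric,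
    vec i + (vec j + vec k) = 0 → i = j ∧ i = k := by
  decide +kernel

theorem quadric_first : ∀ i ∈ quadric, vec i 0 = 1 := by
  decide +kernel

theorem quadric_nodup : (quadric.map vec).Nodup := by
  decide +kernel

/-- The sequence of length forty. -/
def lower : Multiset V := (quadric.map vec : List V) + (quadric.map vec : List V)

theorem mem_lower {x : V} (h : x ∈ lower) : ∃ i ∈ quadric, x = vec i := by
  simp only [lower, Multiset.mem_add, Multiset.mem_coe, List.mem_map, or_self] at h
  obtain ⟨i, hi, rfl⟩ := h
  exact ⟨i, hi, rfl⟩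

theorem count_lower (x : V) : lower.count x ≤ 2 := by
  have := List.nodup_iff_count_le_one.1 quadric_nodup x
  simp only [lower, Multiset.count_add, Multiset.coe_count]
  omega

theorem lower_sum_zero {t : Multiset V} (ht : t ≤ lower) (hc : Multiset.card t = 3)
    (hs : t.sum = 0) : False := by
  obtain ⟨a, b, c, rfl⟩ := Multiset.card_eq_three.1 hc
  obtain ⟨i, hi, rfl⟩ := mem_lower (Multiset.mem_of_le ht (by simp : a ∈ _))
  obtain ⟨j, hj, rfl⟩ := mem_lower (Multiset.mem_of_le ht (by simp : b ∈ _))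
  obtain ⟨k, hk, rfl⟩ := mem_lower (Multiset.mem_of_le ht (by simp : c ∈ _))
  obtain ⟨rfl, rfl⟩ := quadric_cap i hi j hj k hk (by simpa using hs)
  have h1 := Multiset.le_iff_count.1 ht (vec i)
  have h2 := count_lower (vec i)
  simp only [Multiset.insert_eq_cons, Multiset.count_cons_self, Multiset.count_singleton_self] at h1
  omega

theorem sum_first (t : Multiset V) (ht : ∀ x ∈ t, x 0 = 1) :
    t.sum 0 = ((Multiset.card t : Nat) : ZMod 3) := by
  induction t using Multiset.induction_on with
  | empty => simp
  | cons a s ih =>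
    rw [Multiset.sum_cons, Pi.add_apply, ih fun x hx => ht x (Multiset.mem_cons_of_mem hx),
      ht a (Multiset.mem_cons_self a s), Multiset.card_cons, Nat.cast_add, Nat.cast_one, add_comm]

theorem lower_card : Multiset.card lower = 40 := by
  simp [lower, quadric]

theorem lower_not : ¬ HasWZSS lower 3 := by
  rintro ⟨t₁, t₂, hle, hc, hs⟩
  have hfirst : ∀ x ∈ lower, x 0 = 1 := by
    intro x hx
    obtain ⟨i, hi, rfl⟩ := mem_lower hx
    exact quadric_first i hi
  have l1 : t₁ ≤ lower := (Multiset.le_add_right t₁ t₂).trans hle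
  have l2 : t₂ ≤ lower := (Multiset.le_add_left t₂ t₁).trans hle
  have s1 := sum_first t₁ fun x hx => hfirst x (Multiset.mem_of_le l1 hx)
  have s2 := sum_first t₂ fun x hx => hfirst x (Multiset.mem_of_le l2 hx)
  rw [hs, s2, ZMod.natCast_eq_natCast_iff'] at s1
  rw [Multiset.card_add] at hc
  have hcases : Multiset.card t₁ = 3 ∧ Multiset.card t₂ = 0 ∨
      Multiset.card t₁ = 0 ∧ Multiset.card t₂ = 3 := by omega
  rcases hcases with ⟨h1, h2⟩ | ⟨h1, h2⟩
  · rw [Multiset.card_eq_zero] at h2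
    exact lower_sum_zero l1 h1 (by rw [hs, h2, Multiset.sum_zero])
  · rw [Multiset.card_eq_zero] at h1
    exact lower_sum_zero l2 h2 (by rw [← hs, h1, Multiset.sum_zero])

theorem exponent_eq : AddMonoid.exponent (Fin 5 → ZMod 3) = 3 := by
  have h : AddMonoid.exponent (Fin 5 → ZMod 3) ∣ 3 := by
    apply AddMonoid.exponent_dvd_of_forall_nsmul_eq_zero
    intro g
    rw [succ_nsmul, two_nsmul]
    exact three_mul_vec g
  rcases (Nat.dvd_prime Nat.prime_three).1 h with h1 | h1
  · have : (1 : Fin 5 → ZMod 3) = 0 := by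
      have h2 := AddMonoid.exponent_nsmul_eq_zero (1 : Fin 5 → ZMod 3)
      rwa [h1, one_nsmul] at h2
    exact absurd (congrFun this 0) (by decide)
  · exact h1

end CapSearch

/-- `41 ≤ s_A(C_3^5) ≤ 45`; that is, every sequence over `C_3^5` of
length at least `45` has a `{-1,1}`-zero-sum subsequence of length `3`, and there is a
sequence of length `40` with no such subsequence. -/
theorem sA_three_fifth :
    (41 ≤ sA (Fin 5 → ZMod 3) ∧ sA (Fin 5 → ZMod 3) ≤ 45) ∧
    (∀ S : Multiset (Fin 5 → ZMod 3), 45 ≤ Multiset.card S → HasWZSS S 3) ∧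
    ∃ S : Multiset (Fin 5 → ZMod 3), Multiset.card S = 40 ∧ ¬ HasWZSS S 3 := by
  have hup : ∀ S : Multiset (Fin 5 → ZMod 3), 45 ≤ Multiset.card S → HasWZSS S 3 :=
    CapSearch.upper
  have hmem : 45 ∈ {ℓ : ℕ | ∀ S : Multiset (Fin 5 → ZMod 3), ℓ ≤ Multiset.card S →
      HasWZSS S (AddMonoid.exponent (Fin 5 → ZMod 3))} := by
    intro S hS
    rw [CapSearch.exponent_eq]
    exact hup S hS
  refine ⟨⟨?_, Nat.sInf_le hmem⟩, hup, CapSearch.lower, CapSearch.lower_card, CapSearch.lower_not⟩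
  by_contra hlt
  have h := Nat.sInf_mem ⟨45, hmem⟩
  have h2 := h CapSearch.lower (by
    rw [CapSearch.lower_card]
    change sA (Fin 5 → ZMod 3) ≤ 40
    omega)
  rw [CapSearch.exponent_eq] at h2
  exact CapSearch.lower_not h2
end

section
/- Let A = {−1,1}. For every integer a ≥ 1, s_A(C_{3^a}^3) = 4·3^a − 3; that is, every sequence over C_{3^a}^3 of length at least 4·3^a − 3 has an A-zero-sum subsequence of length 3^a, and there exists a sequence over C_{3^a}^3 of length 4·3^a − 4 with no A-zero-sum subsequence of length 3^a. -/
/-- coordinates mod 3 of an integer vector -/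
abbrev V3 := ZMod 3 × ZMod 3 × ZMod 3

/-- reduction mod 3 -/
def red3 (v : Fin 3 → ℤ) : V3 := ((v 0 : ZMod 3), (v 1 : ZMod 3), (v 2 : ZMod 3))

/-- balanced digit -/
def bal (x : ZMod 3) : ℤ := if x = 0 then 0 else if x = 1 then 1 else -1

/-- class of a vector up to sign -/
def code3 (u : V3) : Fin 14 :=
  Fin.ofNat 14 (Int.natAbs (9 * bal u.1 + 3 * bal u.2.1 + bal u.2.2))

/-- representative of a class -/
def dec3 (i : Fin 14) : V3 :=
  (((i.val + 4) / 9 : ℕ), (((i.val + 1) / 3 : ℕ)), ((i.val : ℕ)))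

/-- three vectors admit a signed zero sum -/
def zs (u v w : V3) : Prop := u + v + w = 0 ∨ u + v = w ∨ u + w = v ∨ u = v + w

instance (u v w : V3) : Decidable (zs u v w) := by unfold zs; infer_instance

lemma dec3_code3 : ∀ u : V3, dec3 (code3 u) = u ∨ dec3 (code3 u) = -u := by decide +kernel

lemma zs_neg1 {u v w : V3} (h : zs (-u) v w) : zs u v w := by
  unfold zs at *
  rcases h with h | h | h | h
  · right; right; right; linear_combination -h
  · right; right; left; linear_combination -h
  · right; left; linear_combination -h
  · left; linear_combination -h

lemma zs_neg2 {u v w : V3} (h : zs u (-v) w) : zs u v w := by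
  unfold zs at *
  rcases h with h | h | h | h
  · right; right; left; linear_combination h
  · right; right; right; linear_combination h
  · left; linear_combination h
  · right; left; linear_combination h

lemma zs_neg3 {u v w : V3} (h : zs u v (-w)) : zs u v w := by
  unfold zs at *
  rcases h with h | h | h | h
  · right; left; linear_combination h
  · left; linear_combination h
  · right; right; right; linear_combination h
  · right; right; left; linear_combination h

lemma zs_of_code {u v w : V3} (h : zs (dec3 (code3 u)) (dec3 (code3 v)) (dec3 (code3 w))) :
    zs u v w := by
  rcases dec3_code3 u with hu | hu <;> rcases dec3_code3 v with hv | hv <;>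
    rcases dec3_code3 w with hw | hw <;> rw [hu, hv, hw] at h
  · exact h
  · exact zs_neg3 h
  · exact zs_neg2 h
  · exact zs_neg2 (zs_neg3 h)
  · exact zs_neg1 h
  · exact zs_neg1 (zs_neg3 h)
  · exact zs_neg1 (zs_neg2 h)
  · exact zs_neg1 (zs_neg2 (zs_neg3 h))

/-- signed zero sum on classes -/
def bad (i j k : Fin 14) : Prop := zs (dec3 i) (dec3 j) (dec3 k)

instance (u v w : Fin 14) : Decidable (bad u v w) := by unfold bad; infer_instance

lemma bad_self : ∀ i, bad i i i := by decide +kernel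

lemma bad_zero : ∀ i, bad 0 i i := by decide +kernel

lemma arc5 : ∀ a b : Fin 14, 0 < a → a < b → ∀ c, b < c → bad a b c ∨ ∀ d, c < d →
    bad a b d ∨ bad a c d ∨ bad b c d ∨ ∀ e, d < e →
    bad a b e ∨ bad a c e ∨ bad b c e ∨ bad a d e ∨ bad b d e ∨ bad c d e := by
  decide +kernel

lemma exists_bad (M : Multiset (Fin 14)) (hM : 9 ≤ Multiset.card M) :
    ∃ i j k, ({i, j, k} : Multiset (Fin 14)) ≤ M ∧ bad i j k := by
  by_contra! hno
  have hc : ∀ i, M.count i ≤ 2 := by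
    intro i
    by_contra! h
    refine hno i i i ?_ (bad_self i)
    have : ({i, i, i} : Multiset (Fin 14)) = Multiset.replicate 3 i := rfl
    rw [this]
    exact Multiset.le_count_iff_replicate_le.1 h
  have hsum := Multiset.toFinset_sum_count_eq M
  have h5 : 5 ≤ (M.toFinset.erase 0).card := by
    by_cases h0 : (0 : Fin 14) ∈ M
    · have h1 : ∀ i ∈ M.toFinset.erase 0, M.count i ≤ 1 := by
        intro i hi
        have hi0 : i ≠ 0 := (Finset.mem_erase.1 hi).1
        by_contra! h
        refine hno 0 i i ?_ (bad_zero i)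
        have h2 : ({i, i} : Multiset (Fin 14)) = Multiset.replicate 2 i := rfl
        rw [Multiset.insert_eq_cons, h2, Multiset.cons_le_of_notMem]
        · exact ⟨h0, Multiset.le_count_iff_replicate_le.1 h⟩
        · intro hmem
          exact hi0 (Multiset.eq_of_mem_replicate hmem).symm
      have h2 := Finset.sum_le_card_nsmul _ _ _ h1
      rw [← Finset.add_sum_erase _ _ (Multiset.mem_toFinset.2 h0)] at hsum
      have := hc 0
      simp only [smul_eq_mul] at h2
      omega
    · have : M.toFinset.erase 0 = M.toFinset := by
        apply Finset.erase_eq_of_notMem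
        simpa using h0
      rw [this]
      have h2 := Finset.sum_le_card_nsmul M.toFinset _ _ (fun i _ => hc i)
      simp only [smul_eq_mul] at h2
      omega
  obtain ⟨s, hs, hs5⟩ := Finset.exists_subset_card_eq h5
  let f := s.orderEmbOfFin hs5
  have hf : ∀ i, f i ∈ M ∧ f i ≠ 0 := by
    intro i
    have := hs (s.orderEmbOfFin_mem hs5 i)
    rw [Finset.mem_erase, Multiset.mem_toFinset] at this
    exact ⟨this.2, this.1⟩
  have hlt : ∀ i j, i < j → f i < f j := fun i j h => f.strictMono h
  have hnb : ∀ i j k, i < j → j < k → ¬ bad (f i) (f j) (f k) := by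
    intro i j k hij hjk
    apply hno
    rw [Multiset.le_iff_subset]
    · intro x hx
      simp only [Multiset.insert_eq_cons, Multiset.mem_cons, Multiset.mem_singleton] at hx
      rcases hx with rfl | rfl | rfl
      exacts [(hf _).1, (hf _).1, (hf _).1]
    · have a1 := (hlt _ _ hij).ne
      have a2 := (hlt _ _ hjk).ne
      have a3 := (hlt _ _ (hij.trans hjk)).ne
      simp [a1, a2, a3]
  have := arc5 (f 0) (f 1) (Fin.pos_of_ne_zero (hf 0).2) (hlt 0 1 (by decide)) (f 2)
    (hlt 1 2 (by decide))
  rcases this with h | h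
  · exact hnb 0 1 2 (by decide) (by decide) h
  rcases h (f 3) (hlt 2 3 (by decide)) with h | h | h | h
  · exact hnb 0 1 3 (by decide) (by decide) h
  · exact hnb 0 2 3 (by decide) (by decide) h
  · exact hnb 1 2 3 (by decide) (by decide) h
  rcases h (f 4) (hlt 3 4 (by decide)) with h | h | h | h | h | h
  · exact hnb 0 1 4 (by decide) (by decide) h
  · exact hnb 0 2 4 (by decide) (by decide) h
  · exact hnb 1 2 4 (by decide) (by decide) h
  · exact hnb 0 3 4 (by decide) (by decide) h
  · exact hnb 1 3 4 (by decide) (by decide) h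
  · exact hnb 2 3 4 (by decide) (by decide) h

lemma exists_le_of_le_map {α β : Type*} (f : α → β) (u : Multiset β) :
    ∀ S : Multiset α, u ≤ S.map f → ∃ t, t ≤ S ∧ t.map f = u := by
  classical
  induction u using Multiset.induction_on with
  | empty => intro S _; exact ⟨0, Multiset.zero_le _, rfl⟩
  | cons b u ih =>
    intro S h
    have hb : b ∈ S.map f := Multiset.mem_of_le h (Multiset.mem_cons_self _ _)
    obtain ⟨x, hx, rfl⟩ := Multiset.mem_map.1 hb
    obtain ⟨S', rfl⟩ := Multiset.exists_cons_of_mem hx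
    rw [Multiset.map_cons, Multiset.cons_le_cons_iff] at h
    obtain ⟨t, ht, rfl⟩ := ih S' h
    exact ⟨x ::ₘ t, Multiset.cons_le_cons _ ht, by simp⟩

lemma exists_split_of_map {α β : Type*} (f : α → β) (u₁ u₂ : Multiset β) (S : Multiset α)
    (h : u₁ + u₂ ≤ S.map f) : ∃ t₁ t₂, t₁ + t₂ ≤ S ∧ t₁.map f = u₁ ∧ t₂.map f = u₂ := by
  classical
  obtain ⟨t, ht, hm⟩ := exists_le_of_le_map f _ S h
  obtain ⟨t₁, h1, hm1⟩ := exists_le_of_le_map f u₁ t (by rw [hm]; exact Multiset.le_add_right _ _)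
  obtain ⟨t₂, rfl⟩ := Multiset.le_iff_exists_add.1 h1
  refine ⟨t₁, t₂, ht, hm1, ?_⟩
  rw [Multiset.map_add, hm1] at hm
  exact add_left_cancel hm

/-- signed subsequence of length `k` with sum divisible by `m` -/
def HasD (S : Multiset (Fin 3 → ℤ)) (m : ℤ) (k : ℕ) : Prop :=
  ∃ t₁ t₂ : Multiset (Fin 3 → ℤ), ∃ y : Fin 3 → ℤ, t₁ + t₂ ≤ S ∧
    Multiset.card (t₁ + t₂) = k ∧ t₁.sum - t₂.sum = m • y

lemma red3_add (u v : Fin 3 → ℤ) : red3 (u + v) = red3 u + red3 v := by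
  simp [red3]

lemma red3_eq {u v : Fin 3 → ℤ} (h : red3 u = red3 v) : ∃ y, u - v = (3 : ℤ) • y := by
  simp only [red3, Prod.mk.injEq] at h
  obtain ⟨h0, h1, h2⟩ := h
  have key : ∀ i, (3 : ℤ) ∣ u i - v i := by
    intro i
    have : ((u i - v i : ℤ) : ZMod 3) = 0 := by
      push_cast
      fin_cases i
      · simp [h0]
      · simp [h1]
      · simp [h2]
    exact_mod_cast (ZMod.intCast_zmod_eq_zero_iff_dvd _ 3).1 this
  choose y hy using key
  exact ⟨y, by ext i; simp [hy]⟩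

lemma base3 (S : Multiset (Fin 3 → ℤ)) (hS : 9 ≤ Multiset.card S) : HasD S 3 3 := by
  obtain ⟨i, j, k, hle, hb⟩ := exists_bad (S.map (fun v => code3 (red3 v))) (by simpa using hS)
  have e : ({i, j, k} : Multiset (Fin 14)) = {i} + ({j} + {k}) := rfl
  rw [e] at hle
  obtain ⟨t, r, hS1, ht, hr⟩ := exists_split_of_map _ _ _ _ hle
  obtain ⟨t2, t3, hS2, ht2, ht3⟩ := exists_split_of_map _ _ _ r hr.ge
  obtain ⟨u, rfl, hu⟩ := Multiset.map_eq_singleton.1 ht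
  obtain ⟨v, rfl, hv⟩ := Multiset.map_eq_singleton.1 ht2
  obtain ⟨w, rfl, hw⟩ := Multiset.map_eq_singleton.1 ht3
  have hle' : ({u} : Multiset (Fin 3 → ℤ)) + ({v} + {w}) ≤ S :=
    (add_le_add_right hS2 _).trans hS1
  rw [← hu, ← hv, ← hw] at hb
  rcases zs_of_code hb with h | h | h | h
  · rw [← red3_add, ← red3_add] at h
    have h0 : red3 (u + v + w) = red3 0 := by rw [h]; simp [red3]; rfl
    obtain ⟨y, hy⟩ := red3_eq h0
    exact ⟨{u} + ({v} + {w}), 0, y, by simpa using hle', by simp, by rw [← hy]; simp; abel⟩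
  · rw [← red3_add] at h
    obtain ⟨y, hy⟩ := red3_eq h
    exact ⟨{u} + {v}, {w}, y, by rwa [add_assoc], by simp, by rw [← hy]; simp⟩
  · rw [← red3_add] at h
    obtain ⟨y, hy⟩ := red3_eq h
    exact ⟨{u} + {w}, {v}, y, by rwa [add_assoc, add_comm ({w} : Multiset (Fin 3 → ℤ))], by simp, by rw [← hy]; simp⟩
  · rw [← red3_add] at h
    obtain ⟨y, hy⟩ := red3_eq h
    exact ⟨{u}, {v} + {w}, y, hle', by simp, by rw [← hy]; simp⟩

/-- a signed triple with a third of its sum -/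
abbrev Trip := Multiset (Fin 3 → ℤ) × Multiset (Fin 3 → ℤ) × (Fin 3 → ℤ)

lemma extract3 (k : ℕ) : ∀ S : Multiset (Fin 3 → ℤ), 3 * k + 6 ≤ Multiset.card S →
    ∃ T : Multiset Trip, Multiset.card T = k ∧ (T.map (fun q => q.1 + q.2.1)).sum ≤ S ∧
      ∀ q ∈ T, Multiset.card (q.1 + q.2.1) = 3 ∧ q.1.sum - q.2.1.sum = (3 : ℤ) • q.2.2 := by
  induction k with
  | zero => intro S _; exact ⟨0, rfl, by simp, by simp⟩
  | succ k ih =>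
    intro S hS
    obtain ⟨t₁, t₂, y, hle, hc, hy⟩ := base3 S (by omega)
    obtain ⟨S', rfl⟩ := Multiset.le_iff_exists_add.1 hle
    obtain ⟨T, hT, hTS, hq⟩ := ih S' (by rw [Multiset.card_add, hc] at hS; omega)
    refine ⟨(t₁, t₂, y) ::ₘ T, by simp [hT], ?_, ?_⟩
    · rw [Multiset.map_cons, Multiset.sum_cons]
      exact add_le_add_right hTS _
    · intro q hq'
      rcases Multiset.mem_cons.1 hq' with rfl | h
      · exact ⟨hc, hy⟩
      · exact hq q h

lemma trip_sum (U : Multiset Trip)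
    (h : ∀ q ∈ U, Multiset.card (q.1 + q.2.1) = 3 ∧ q.1.sum - q.2.1.sum = (3 : ℤ) • q.2.2) :
    (U.map (fun q : Trip => q.1)).sum.sum - (U.map (fun q : Trip => q.2.1)).sum.sum
      = (3 : ℤ) • (U.map (fun q => q.2.2)).sum ∧
    Multiset.card (U.map (fun q => q.1)).sum + Multiset.card (U.map (fun q => q.2.1)).sum
      = 3 * Multiset.card U := by
  induction U using Multiset.induction_on with
  | empty => simp
  | cons q U ih =>
    obtain ⟨h1, h2⟩ := ih (fun q hq => h q (Multiset.mem_cons_of_mem hq))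
    obtain ⟨h3, h4⟩ := h q (Multiset.mem_cons_self _ _)
    simp only [Multiset.map_cons, Multiset.sum_cons, Multiset.sum_add, Multiset.card_add,
      Multiset.card_cons, smul_add] at *
    refine ⟨?_, by omega⟩
    rw [← h4, ← h1]
    abel

lemma hasD_pow (a : ℕ) : ∀ S : Multiset (Fin 3 → ℤ), 4 * 3 ^ a - 3 ≤ Multiset.card S →
    HasD S (3 ^ a) (3 ^ a) := by
  induction a with
  | zero =>
    intro S hS
    have : 0 < Multiset.card S := by simp at hS; omega
    obtain ⟨v, hv⟩ := Multiset.card_pos_iff_exists_mem.1 this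
    exact ⟨{v}, 0, v, by simpa using hv, by simp, by simp⟩
  | succ a ih =>
    intro S hS
    have hp : 0 < 3 ^ a := by positivity
    obtain ⟨T, hT, hTS, hq⟩ := extract3 (4 * 3 ^ a - 3) S (by rw [pow_succ] at hS; omega)
    obtain ⟨u₁, u₂, y, hle, hc, hy⟩ := ih (T.map (fun q => q.2.2)) (by simp [hT])
    obtain ⟨U₁, U₂, hU, rfl, rfl⟩ := exists_split_of_map _ _ _ _ hle
    obtain ⟨R, rfl⟩ := Multiset.le_iff_exists_add.1 hU
    obtain ⟨a1, a2⟩ := trip_sum U₁ (fun q h => hq q (by simp [h]))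
    obtain ⟨b1, b2⟩ := trip_sum U₂ (fun q h => hq q (by simp [h]))
    refine ⟨(U₁.map (fun q => q.1)).sum + (U₂.map (fun q => q.2.1)).sum,
      (U₁.map (fun q => q.2.1)).sum + (U₂.map (fun q => q.1)).sum, y, ?_, ?_, ?_⟩
    · refine le_trans ?_ hTS
      simp only [Multiset.map_add, Multiset.sum_add, Multiset.sum_map_add]
      refine le_trans (le_of_eq ?_) (Multiset.le_add_right _ _)
      abel
    · simp only [Multiset.card_add, Multiset.card_map, pow_succ] at *
      omega
    · simp only [Multiset.sum_add]
      rw [pow_succ', mul_smul, ← hy, smul_sub, ← a1, ← b1]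
      abel

lemma upper (a : ℕ) (S : Multiset (Fin 3 → ZMod (3 ^ a)))
    (hS : 4 * 3 ^ a - 3 ≤ Multiset.card S) : HasWZSS S (3 ^ a) := by
  let g : (Fin 3 → ℤ) →+ (Fin 3 → ZMod (3 ^ a)) :=
    { toFun := fun v i => (v i : ZMod (3 ^ a))
      map_zero' := by ext; simp
      map_add' := by intros; ext; simp }
  let l : (Fin 3 → ZMod (3 ^ a)) → (Fin 3 → ℤ) := fun v i => (v i).cast
  have hgl : ∀ v, g (l v) = v := by
    intro v
    ext i
    simp [g, l]
  obtain ⟨t₁, t₂, y, hle, hc, hy⟩ := hasD_pow a (S.map l) (by simpa using hS)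
  refine ⟨t₁.map g, t₂.map g, ?_, by simpa using hc, ?_⟩
  · have := Multiset.map_le_map (f := g) hle
    simpa [Multiset.map_map, Function.comp_def, hgl] using this
  · rw [← map_multiset_sum, ← map_multiset_sum, ← sub_eq_zero, ← map_sub, hy]
    ext i
    have : ((3 : ZMod (3 ^ a)) ^ a) = 0 := by
      have := ZMod.natCast_self (3 ^ a)
      push_cast at this
      exact this
    simp [g, this]

lemma split_rep {α : Type*} (n : ℕ) (v : α) (B t : Multiset α)
    (h : t ≤ Multiset.replicate n v + B) :
    ∃ p q t', p + q = n ∧ t' ≤ B ∧ t = Multiset.replicate p v + t' := by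
  classical
  have h1 : t ∩ Multiset.replicate n v ≤ Multiset.replicate n v := Multiset.inter_le_right
  obtain ⟨p, hp, hp'⟩ := Multiset.le_replicate_iff.1 h1
  refine ⟨p, n - p, t - Multiset.replicate n v, by omega, ?_, ?_⟩
  · exact tsub_le_iff_left.2 h
  · rw [← hp', add_comm, Multiset.sub_add_inter]

lemma split4 {α : Type*} (n1 n2 n3 n4 : ℕ) (v1 v2 v3 v4 : α) (t : Multiset α)
    (h : t ≤ Multiset.replicate n1 v1 + (Multiset.replicate n2 v2 + (Multiset.replicate n3 v3 +
      (Multiset.replicate n4 v4 + 0)))) :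
    ∃ p1 p2 p3 p4 q1 q2 q3 q4, p1 + q1 = n1 ∧ p2 + q2 = n2 ∧ p3 + q3 = n3 ∧ p4 + q4 = n4 ∧
      t = Multiset.replicate p1 v1 + (Multiset.replicate p2 v2 + (Multiset.replicate p3 v3 +
      (Multiset.replicate p4 v4 + 0))) := by
  obtain ⟨p1, q1, t1, e1, h1, rfl⟩ := split_rep _ _ _ _ h
  obtain ⟨p2, q2, t2, e2, h2, rfl⟩ := split_rep _ _ _ _ h1
  obtain ⟨p3, q3, t3, e3, h3, rfl⟩ := split_rep _ _ _ _ h2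
  obtain ⟨p4, q4, t4, e4, h4, rfl⟩ := split_rep _ _ _ _ h3
  obtain rfl := Multiset.le_zero.1 h4
  exact ⟨p1, p2, p3, p4, q1, q2, q3, q4, e1, e2, e3, e4, rfl⟩

lemma dvd_cases (n : ℕ) (hn : 0 < n) (x : ℤ) (h : (n : ℤ) ∣ x) (h1 : x ≤ n) (h2 : -n ≤ x) :
    x = 0 ∨ x = n ∨ x = -n := by
  obtain ⟨k, rfl⟩ := h
  have hn' : (0 : ℤ) < n := by exact_mod_cast hn
  have k1 : k ≤ 1 := by nlinarith
  have k2 : -1 ≤ k := by nlinarith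
  interval_cases k <;> simp

lemma lower (n : ℕ) (hn : Odd n) : ∃ S : Multiset (Fin 3 → ZMod n),
    Multiset.card S = 4 * n - 4 ∧ ¬ HasWZSS S n := by
  refine ⟨Multiset.replicate (n - 1) ![1, 0, 0] + (Multiset.replicate (n - 1) ![0, 1, 0] +
    (Multiset.replicate (n - 1) ![0, 0, 1] + (Multiset.replicate (n - 1) ![1, 1, 1] + 0))),
    by simp; omega, ?_⟩
  rintro ⟨t₁, t₂, hle, hc, hs⟩
  obtain ⟨p1, p2, p3, p4, q1, q2, q3, q4, e1, e2, e3, e4, rfl⟩ :=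
    split4 _ _ _ _ _ _ _ _ t₁ ((Multiset.le_add_right _ _).trans hle)
  have hle2 : t₂ ≤ Multiset.replicate q1 ![1, 0, 0] + (Multiset.replicate q2 ![0, 1, 0] +
    (Multiset.replicate q3 ![0, 0, 1] + (Multiset.replicate q4 ![1, 1, 1] + 0))) := by
    refine le_of_add_le_add_left (hle.trans (le_of_eq ?_))
    nth_rewrite 1 [← e1]
    nth_rewrite 1 [← e2]
    nth_rewrite 1 [← e3]
    rw [← e4]
    simp only [Multiset.replicate_add]
    abel
  obtain ⟨r1, r2, r3, r4, s1, s2, s3, s4, f1, f2, f3, f4, rfl⟩ := split4 _ _ _ _ _ _ _ _ t₂ hle2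
  simp only [Multiset.card_add, Multiset.card_replicate, Multiset.card_zero] at hc
  simp only [Multiset.sum_add, Multiset.sum_replicate, Multiset.sum_zero] at hs
  have c0 := congrFun hs 0
  have c1 := congrFun hs 1
  have c2 := congrFun hs 2
  simp at c0 c1 c2
  have d0 : (n : ℤ) ∣ (p1 + p4 - r1 - r4 : ℤ) := by
    rw [← ZMod.intCast_zmod_eq_zero_iff_dvd]
    push_cast
    linear_combination c0
  have d1 : (n : ℤ) ∣ (p2 + p4 - r2 - r4 : ℤ) := by
    rw [← ZMod.intCast_zmod_eq_zero_iff_dvd]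
    push_cast
    linear_combination c1
  have d2 : (n : ℤ) ∣ (p3 + p4 - r3 - r4 : ℤ) := by
    rw [← ZMod.intCast_zmod_eq_zero_iff_dvd]
    push_cast
    linear_combination c2
  obtain ⟨m, rfl⟩ := hn
  have x0 := dvd_cases _ (by omega) _ d0 (by omega) (by omega)
  have x1 := dvd_cases _ (by omega) _ d1 (by omega) (by omega)
  have x2 := dvd_cases _ (by omega) _ d2 (by omega) (by omega)
  clear d0 d1 d2 c0 c1 c2 hs hle hle2
  rcases x0 with x0 | x0 | x0 <;> rcases x1 with x1 | x1 | x1 <;>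
    rcases x2 with x2 | x2 | x2 <;> omega

lemma exponent_cube (n : ℕ) : AddMonoid.exponent (Fin 3 → ZMod n) = n := by
  apply Nat.dvd_antisymm
  · apply AddMonoid.exponent_dvd_of_forall_nsmul_eq_zero
    intro g
    ext i
    simp
  · have := AddMonoid.exponent_nsmul_eq_zero (G := Fin 3 → ZMod n) (fun _ => 1)
    have h0 := congrFun this 0
    simp at h0
    exact (ZMod.natCast_eq_zero_iff _ _).1 h0

theorem sA_three_pow_cubed (a : ℕ) (ha : 1 ≤ a) :
    sA (Fin 3 → ZMod (3 ^ a)) = 4 * 3 ^ a - 3 ∧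
    (∀ S : Multiset (Fin 3 → ZMod (3 ^ a)),
      4 * 3 ^ a - 3 ≤ Multiset.card S → HasWZSS S (3 ^ a)) ∧
    ∃ S : Multiset (Fin 3 → ZMod (3 ^ a)),
      Multiset.card S = 4 * 3 ^ a - 4 ∧ ¬ HasWZSS S (3 ^ a) := by
  have hl := lower (3 ^ a) (Odd.pow (by decide))
  refine ⟨?_, upper a, hl⟩
  unfold sA
  rw [exponent_cube]
  apply le_antisymm
  · exact Nat.sInf_le (fun S hS => upper a S hS)
  · refine le_csInf ⟨_, fun S hS => upper a S hS⟩ ?_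
    intro b hb
    by_contra! hlt
    obtain ⟨S, hS, hno⟩ := hl
    exact hno (hb S (by omega))
end
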